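/- arXiv:1411.3366 — 2 statements merged into one kernel-verified Lean document; each statement's English description precedes it below -/
import Mathlib

section
/- Let Z and Y be Banach spaces (over the reals). If there exists a bijection h : Z → Y such that both h and its inverse are uniformly continuous (i.e., Z and Y are uniformly homeomorphic), then Z is crudely finitely representable in Y and Y is crudely finitely representable in Z. -/
noncomputable section

/-- `X` is crudely finitely representable in `Y`: there is a constant `1 ≤ C < ∞` such that
for every finite-dimensional subspace `F` of `X` there is a finite-dimensional subspace `G`
of `Y` and a linear isomorphism `T : F → G` with `‖T‖·‖T⁻¹‖ ≤ C`. -/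
def CrudelyFinitelyRepresentable (X Y : Type) [NormedAddCommGroup X] [NormedSpace ℝ X]
    [NormedAddCommGroup Y] [NormedSpace ℝ Y] : Prop :=
  ∃ C : ℝ, 1 ≤ C ∧ ∀ F : Submodule ℝ X, FiniteDimensional ℝ F →
    ∃ G : Submodule ℝ Y, FiniteDimensional ℝ G ∧
      ∃ T : F ≃L[ℝ] G, ‖(T : F →L[ℝ] G)‖ * ‖(T.symm : G →L[ℝ] F)‖ ≤ C

open Filter Topology

section Averages

theorem norm_sum_sub_sum_le {α E : Type*} [DecidableEq α] [NormedAddCommGroup E] (s t : Finset α)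
    (hst : s.card = t.card) (φ : α → E) {B : ℝ} (h : ∀ y, ‖φ y‖ ≤ B) :
    ‖∑ y ∈ s, φ y - ∑ y ∈ t, φ y‖ ≤ 2 * B * (t.card - (s ∩ t).card) := by
  have hs := Finset.sum_sdiff (f := φ) (Finset.inter_subset_left (s₁ := s) (s₂ := t))
  have ht := Finset.sum_sdiff (f := φ) (Finset.inter_subset_right (s₁ := s) (s₂ := t))
  have cs := Finset.card_sdiff_add_card_eq_card (Finset.inter_subset_left (s₁ := s) (s₂ := t))
  have ct := Finset.card_sdiff_add_card_eq_card (Finset.inter_subset_right (s₁ := s) (s₂ := t))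
  rw [← hs, ← ht, add_sub_add_right_eq_sub]
  have h1 := norm_sum_le_of_le (s \ (s ∩ t)) fun y _ => h y
  have h2 := norm_sum_le_of_le (t \ (s ∩ t)) fun y _ => h y
  simp only [Finset.sum_const, nsmul_eq_mul] at h1 h2
  have e1 : ((s \ (s ∩ t)).card : ℝ) = t.card - (s ∩ t).card := by
    rw [← hst, ← cs]; push_cast; ring
  have e2 : ((t \ (s ∩ t)).card : ℝ) = t.card - (s ∩ t).card := by
    rw [← ct]; push_cast; ring
  rw [e1] at h1
  rw [e2] at h2
  calc _ ≤ _ := norm_sub_le _ _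
    _ ≤ _ := add_le_add h1 h2
    _ = _ := by ring

variable {ι : Type*} [Fintype ι] {E : Type*} [NormedAddCommGroup E] [NormedSpace ℝ E]

/-- The box `{0, …, R}^ι` in the lattice `ℤ^ι`. -/
def latticeBox (ι : Type*) [Fintype ι] (R : ℕ) : Finset (ι → ℤ) := by
  classical exact Fintype.piFinset fun _ => Finset.Ico 0 ((R : ℤ) + 1)

/-- The average of `φ` over the box `{0, …, R}^ι`. -/
def boxAvg (R : ℕ) (φ : (ι → ℤ) → E) : E :=
  ((latticeBox ι R).card : ℝ)⁻¹ • ∑ y ∈ latticeBox ι R, φ y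

theorem card_latticeBox (R : ℕ) : (latticeBox ι R).card = (R + 1) ^ Fintype.card ι := by
  classical
  simp only [latticeBox, Fintype.card_piFinset, Int.card_Ico, Finset.prod_const,
    Finset.card_univ]
  congr 1

theorem card_latticeBox_pos (R : ℕ) : (0 : ℝ) < (latticeBox ι R).card := by
  rw [card_latticeBox]; positivity

theorem boxAvg_add (R : ℕ) (φ ψ : (ι → ℤ) → E) :
    boxAvg R (fun y => φ y + ψ y) = boxAvg R φ + boxAvg R ψ := by
  simp [boxAvg, Finset.sum_add_distrib]

theorem boxAvg_sub (R : ℕ) (φ ψ : (ι → ℤ) → E) :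
    boxAvg R (fun y => φ y - ψ y) = boxAvg R φ - boxAvg R ψ := by
  simp [boxAvg, Finset.sum_sub_distrib, smul_sub]

theorem boxAvg_smul (R : ℕ) (c : ℝ) (φ : (ι → ℤ) → E) :
    boxAvg R (fun y => c • φ y) = c • boxAvg R φ := by
  simp only [boxAvg, ← Finset.smul_sum]
  rw [smul_comm]

theorem boxAvg_const (R : ℕ) (a : E) : boxAvg R (fun _ : ι → ℤ => a) = a := by
  have := (card_latticeBox_pos (ι := ι) R).ne'
  rw [boxAvg, Finset.sum_const, ← Nat.cast_smul_eq_nsmul ℝ, smul_smul, inv_mul_cancel₀ this,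
    one_smul]

theorem boxAvg_mono (R : ℕ) {φ ψ : (ι → ℤ) → ℝ} (h : ∀ y, φ y ≤ ψ y) :
    boxAvg R φ ≤ boxAvg R ψ := by
  have := (card_latticeBox_pos (ι := ι) R).le
  exact smul_le_smul_of_nonneg_left (Finset.sum_le_sum fun y _ => h y) (inv_nonneg.2 this)

theorem norm_boxAvg_le (R : ℕ) (φ : (ι → ℤ) → E) :
    ‖boxAvg R φ‖ ≤ boxAvg R (fun y => ‖φ y‖) := by
  rw [boxAvg, boxAvg, norm_smul, norm_inv, Real.norm_natCast, smul_eq_mul]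
  gcongr
  exact norm_sum_le _ _

theorem norm_boxAvg_le_of_le (R : ℕ) {φ : (ι → ℤ) → E} {B : ℝ} (h : ∀ y, ‖φ y‖ ≤ B) :
    ‖boxAvg R φ‖ ≤ B :=
  (norm_boxAvg_le R φ).trans <| (boxAvg_mono R h).trans_eq (boxAvg_const R B)

/-- The boxes form a Følner sequence: averages of a bounded function over a box and over its
translate by `v` differ by a quantity that tends to zero, uniformly in the function. -/
theorem exists_boxAvg_shift_le (v : ι → ℤ) :
    ∃ δ : ℕ → ℝ, Tendsto δ atTop (𝓝 0) ∧ ∀ (E : Type) [NormedAddCommGroup E] [NormedSpace ℝ E]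
      (φ : (ι → ℤ) → E) (B : ℝ), (∀ y, ‖φ y‖ ≤ B) →
      ∀ R, ‖boxAvg R (fun y => φ (y + v)) - boxAvg R φ‖ ≤ B * δ R := by
  classical
  let Q := latticeBox ι
  let Q' : ℕ → Finset (ι → ℤ) := fun R => (Q R).map (addRightEmbedding v)
  have hQ' : ∀ R, Q' R = Fintype.piFinset fun i => Finset.Ico (v i) ((R : ℤ) + 1 + v i) := by
    intro R
    ext y
    simp only [Q', Q, latticeBox, Finset.mem_map, Fintype.mem_piFinset, Finset.mem_Ico,
      addRightEmbedding_apply]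
    constructor
    · rintro ⟨z, hz, rfl⟩ i
      have := hz i
      simp only [Pi.add_apply]
      omega
    · intro h
      refine ⟨y - v, fun i => ?_, sub_add_cancel _ _⟩
      have := h i
      simp only [Pi.sub_apply]
      omega
  have hinter : ∀ R, Q' R ∩ Q R = Fintype.piFinset fun i =>
      Finset.Ico (max (v i) 0) (min ((R : ℤ) + 1 + v i) ((R : ℤ) + 1)) := by
    intro R
    ext y
    rw [hQ']
    simp only [Q, latticeBox, Finset.mem_inter, Fintype.mem_piFinset, Finset.mem_Ico,
      ← forall_and]
    refine forall_congr' fun i => ?_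
    omega
  refine ⟨fun R => 2 * (1 - ((Q' R ∩ Q R).card : ℝ) / (Q R).card), ?_, ?_⟩
  · have hev : ∀ᶠ R : ℕ in atTop, ((Q' R ∩ Q R).card : ℝ) / (Q R).card
        = ∏ i : ι, (1 - |(v i : ℝ)| * (1 / ((R : ℝ) + 1))) := by
      have : ∀ᶠ R : ℕ in atTop, ∀ i, |v i| ≤ R := by
        rw [eventually_all]
        intro i
        filter_upwards [eventually_ge_atTop (v i).natAbs] with R hR
        rw [Int.abs_eq_natAbs]
        exact_mod_cast hR
      filter_upwards [this] with R hR
      rw [hinter, Fintype.card_piFinset, card_latticeBox, ← Finset.card_univ,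
        ← Finset.prod_const]
      push_cast
      rw [← Finset.prod_div_distrib]
      refine Finset.prod_congr rfl fun i _ => ?_
      have h1 : ((min ((R : ℤ) + 1 + v i) ((R : ℤ) + 1) - max (v i) 0).toNat : ℤ)
          = (R : ℤ) + 1 - |v i| := by
        have := hR i
        grind
      have h2 : ((min ((R : ℤ) + 1 + v i) ((R : ℤ) + 1) - max (v i) 0).toNat : ℝ)
          = (R : ℝ) + 1 - |(v i : ℝ)| := by
        exact_mod_cast h1
      rw [Int.card_Ico, h2]
      field_simp
    have hlim : Tendsto (fun R : ℕ => ∏ i : ι, (1 - |(v i : ℝ)| * (1 / ((R : ℝ) + 1)))) atTop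
        (𝓝 (∏ i : ι, (1 - |(v i : ℝ)| * 0))) :=
      tendsto_finsetProd _ fun i _ =>
        (tendsto_one_div_add_atTop_nhds_zero_nat.const_mul _).const_sub _
    simp only [mul_zero, sub_zero, Finset.prod_const_one] at hlim
    have := ((hlim.congr' (hev.mono fun _ h => h.symm)).const_sub 1).const_mul 2
    simpa using this
  · intro E _ _ φ B hφ R
    have hpos := card_latticeBox_pos (ι := ι) R
    have hsum : ∑ y ∈ Q R, φ (y + v) = ∑ y ∈ Q' R, φ y := by simp [Q']
    have := norm_sum_sub_sum_le (Q' R) (Q R) (by simp [Q']) φ hφ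
    rw [boxAvg, boxAvg, ← smul_sub, hsum, norm_smul, norm_inv, Real.norm_natCast,
      inv_mul_le_iff₀ hpos]
    refine this.trans_eq ?_
    simp only [Q] at *
    field_simp

end Averages

section InvariantMean

/-- A function is bounded in absolute value. -/
def IsBddFun {G : Type*} (φ : G → ℝ) : Prop := ∃ B, ∀ x, |φ x| ≤ B

/-- `M` restricts to an invariant mean on the bounded real functions on `G`. -/
structure IsInvariantMean {G : Type*} [Add G] (M : (G → ℝ) → ℝ) : Prop where
  map_add : ∀ φ ψ, IsBddFun φ → IsBddFun ψ → M (fun x => φ x + ψ x) = M φ + M ψ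
  map_smul : ∀ (c : ℝ) φ, IsBddFun φ → M (fun x => c * φ x) = c * M φ
  mono : ∀ φ ψ, IsBddFun φ → IsBddFun ψ → (∀ x, φ x ≤ ψ x) → M φ ≤ M ψ
  map_const : ∀ a : ℝ, M (fun _ => a) = a
  map_shift : ∀ φ v, IsBddFun φ → M (fun x => φ (x + v)) = M φ

theorem exists_isInvariantMean (ι : Type*) [Fintype ι] :
    ∃ M : ((ι → ℤ) → ℝ) → ℝ, IsInvariantMean M := by
  have hex : ∀ φ : (ι → ℤ) → ℝ, ∃ a, IsBddFun φ →
      Tendsto (fun R => boxAvg R φ) (hyperfilter ℕ : Filter ℕ) (𝓝 a) := by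
    intro φ
    by_cases h : IsBddFun φ
    · obtain ⟨B, hB⟩ := h
      obtain ⟨a, -, ha⟩ := (isCompact_Icc (a := -B) (b := B)).ultrafilter_le_nhds
        ((hyperfilter ℕ).map fun R => boxAvg R φ) (by
          rw [le_principal_iff]
          exact mem_map.2 (Filter.univ_mem' fun R =>
            abs_le.1 ((Real.norm_eq_abs _).symm.trans_le (norm_boxAvg_le_of_le R hB))))
      exact ⟨a, fun _ => ha⟩
    · exact ⟨0, fun h' => absurd h' h⟩
  choose M hM using hex
  refine ⟨M, ?_, ?_, ?_, ?_, ?_⟩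
  · rintro φ ψ ⟨B, hB⟩ ⟨B', hB'⟩
    refine tendsto_nhds_unique (hM _ ⟨B + B', fun x => ?_⟩) ?_
    · exact (abs_add_le _ _).trans (add_le_add (hB x) (hB' x))
    · simpa only [boxAvg_add] using (hM φ ⟨B, hB⟩).add (hM ψ ⟨B', hB'⟩)
  · rintro c φ ⟨B, hB⟩
    refine tendsto_nhds_unique (hM _ ⟨|c| * B, fun x => ?_⟩) ?_
    · rw [abs_mul]
      exact mul_le_mul_of_nonneg_left (hB x) (abs_nonneg c)
    · have := (hM φ ⟨B, hB⟩).const_mul c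
      simpa only [← smul_eq_mul, ← boxAvg_smul] using this
  · intro φ ψ hφ hψ h
    exact le_of_tendsto_of_tendsto' (hM φ hφ) (hM ψ hψ) fun R => boxAvg_mono R h
  · intro a
    refine tendsto_nhds_unique (hM _ ⟨|a|, fun _ => le_rfl⟩) ?_
    simp only [boxAvg_const]
    exact tendsto_const_nhds
  · rintro φ v ⟨B, hB⟩
    obtain ⟨δ, hδ, h⟩ := exists_boxAvg_shift_le v
    refine tendsto_nhds_unique (hM _ ⟨B, fun x => hB _⟩) ?_
    have h0 : Tendsto (fun R => boxAvg R (fun y => φ (y + v)) - boxAvg R φ)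
        (hyperfilter ℕ : Filter ℕ) (𝓝 0) :=
      (squeeze_zero_norm (h ℝ φ B hB) (by simpa using hδ.const_mul B)).mono_left
        Nat.hyperfilter_le_atTop
    simpa using h0.add (hM φ ⟨B, hB⟩)

end InvariantMean

section InvariantMeanLemmas

variable {G : Type*}

theorem IsBddFun.add {φ ψ : G → ℝ} (hφ : IsBddFun φ) (hψ : IsBddFun ψ) :
    IsBddFun fun x => φ x + ψ x := by
  obtain ⟨B, hB⟩ := hφ
  obtain ⟨B', hB'⟩ := hψ
  exact ⟨B + B', fun x => (abs_add_le _ _).trans (add_le_add (hB x) (hB' x))⟩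

theorem IsBddFun.const_mul {φ : G → ℝ} (hφ : IsBddFun φ) (c : ℝ) :
    IsBddFun fun x => c * φ x := by
  obtain ⟨B, hB⟩ := hφ
  refine ⟨|c| * B, fun x => ?_⟩
  rw [abs_mul]
  exact mul_le_mul_of_nonneg_left (hB x) (abs_nonneg c)

theorem isBddFun_const (a : ℝ) : IsBddFun fun _ : G => a := ⟨|a|, fun _ => le_rfl⟩

theorem IsBddFun.sum {α : Type*} (s : Finset α) {φ : α → G → ℝ} (hφ : ∀ i, IsBddFun (φ i)) :
    IsBddFun fun x => ∑ i ∈ s, φ i x := by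
  classical
  induction s using Finset.induction_on with
  | empty => simpa using isBddFun_const 0
  | insert a s ha ih =>
    simp only [Finset.sum_insert ha]
    exact (hφ a).add ih

namespace IsInvariantMean

variable [Add G] {M : (G → ℝ) → ℝ} (hM : IsInvariantMean M)

include hM

theorem map_sum {α : Type*} (s : Finset α) {φ : α → G → ℝ} (hφ : ∀ i, IsBddFun (φ i)) :
    M (fun x => ∑ i ∈ s, φ i x) = ∑ i ∈ s, M (φ i) := by
  classical
  induction s using Finset.induction_on with
  | empty => simpa using hM.map_const 0
  | insert a s ha ih =>
    simp only [Finset.sum_insert ha]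
    rw [hM.map_add _ _ (hφ a) (IsBddFun.sum s hφ), ih]

theorem map_sub {φ ψ : G → ℝ} (hφ : IsBddFun φ) (hψ : IsBddFun ψ) :
    M (fun x => φ x - ψ x) = M φ - M ψ := by
  have h1 := hM.map_add φ _ hφ (hψ.const_mul (-1))
  rw [hM.map_smul _ _ hψ] at h1
  simpa [sub_eq_add_neg] using h1

theorem exists_lt {φ : G → ℝ} (hφ : IsBddFun φ) {a : ℝ} (h : M φ < a) : ∃ x, φ x < a := by
  by_contra! h'
  exact h.not_ge <| (hM.map_const a).symm.trans_le <| hM.mono _ _ (isBddFun_const a) hφ h'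

end IsInvariantMean

theorem IsInvariantMean.map_boxAvg {ι : Type*} [Fintype ι] {M : ((ι → ℤ) → ℝ) → ℝ}
    (hM : IsInvariantMean M) {φ : (ι → ℤ) → ℝ} (hφ : IsBddFun φ) (R : ℕ) :
    M (fun x => boxAvg R fun y => φ (x + y)) = M φ := by
  have hs : ∀ y, IsBddFun fun x => φ (x + y) := fun y => hφ.imp fun B hB x => hB _
  simp only [boxAvg, smul_eq_mul]
  rw [hM.map_smul _ _ (IsBddFun.sum _ hs), hM.map_sum _ hs,
    Finset.sum_congr rfl fun y _ => hM.map_shift φ y hφ, Finset.sum_const, nsmul_eq_mul,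
    inv_mul_cancel_left₀ (card_latticeBox_pos R).ne']

end InvariantMeanLemmas

section Increments

variable {G E : Type*} [AddCommGroup G] [NormedAddCommGroup E]

/-- All increments of `f` in a fixed direction are bounded. -/
def BddIncrements (f : G → E) : Prop := ∀ v, ∃ B, ∀ x, ‖f (x + v) - f x‖ ≤ B

theorem BddIncrements.isBddFun {f : G → E} (hf : BddIncrements f) (v : G) :
    IsBddFun fun x => ‖f (x + v) - f x‖ :=
  (hf v).imp fun B hB x => by simpa using hB x

/-- The mean size of the increments of `f` in the direction `v`. -/
def meanIncrement (M : (G → ℝ) → ℝ) (f : G → E) (v : G) : ℝ := M fun x => ‖f (x + v) - f x‖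

variable {M : (G → ℝ) → ℝ} (hM : IsInvariantMean M) {f : G → E} (hf : BddIncrements f)

include hM hf

theorem meanIncrement_nonneg (v : G) : 0 ≤ meanIncrement M f v :=
  (hM.map_const 0).symm.trans_le <|
    hM.mono _ _ (isBddFun_const 0) (hf.isBddFun v) fun _ => norm_nonneg _

theorem meanIncrement_add_le (v w : G) :
    meanIncrement M f (v + w) ≤ meanIncrement M f v + meanIncrement M f w := by
  have hs : IsBddFun fun x => ‖f (x + w + v) - f (x + w)‖ :=
    (hf.isBddFun v).imp fun B hB x => hB (x + w)
  have h1 := hM.map_shift _ w (hf.isBddFun v)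
  have h2 := hM.map_add _ _ hs (hf.isBddFun w)
  unfold meanIncrement
  rw [← h1, ← h2]
  refine hM.mono _ _ (hf.isBddFun _) (hs.add (hf.isBddFun w)) fun x => ?_
  have : f (x + (v + w)) - f x = (f (x + w + v) - f (x + w)) + (f (x + w) - f x) := by
    rw [add_comm v w, ← add_assoc]; abel
  rw [this]
  exact norm_add_le _ _

theorem meanIncrement_nsmul_le (k : ℕ) (v : G) :
    meanIncrement M f (k • v) ≤ k * meanIncrement M f v := by
  induction k with
  | zero =>
    have := hM.map_const 0
    simp [meanIncrement, this]
  | succ k ih =>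
    rw [succ_nsmul]
    refine (meanIncrement_add_le hM hf _ _).trans ?_
    push_cast
    linarith

theorem meanIncrement_subadditive (v : G) : Subadditive fun t => meanIncrement M f (t • v) := by
  intro m n
  simp only [add_nsmul]
  exact meanIncrement_add_le hM hf _ _

theorem bddBelow_meanIncrement_div (v : G) :
    BddBelow (Set.range fun t : ℕ => meanIncrement M f (t • v) / t) := by
  refine ⟨0, ?_⟩
  rintro _ ⟨t, rfl⟩
  exact div_nonneg (meanIncrement_nonneg hM hf _) t.cast_nonneg

/-- The asymptotic mean speed of `f` is a lower bound for the mean increments of every function at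
bounded distance from `f`. -/
theorem lim_mul_le_meanIncrement {g : G → E} (hg : BddIncrements g) {D : ℝ}
    (hD : ∀ x, ‖g x - f x‖ ≤ D) (v : G) (t : ℕ) :
    (meanIncrement_subadditive hM hf v).lim * t ≤ meanIncrement M g (t • v) := by
  rcases eq_or_ne t 0 with rfl | ht
  · simpa using meanIncrement_nonneg hM hg 0
  have key : ∀ k : ℕ, k ≠ 0 → k * ((meanIncrement_subadditive hM hf v).lim * t) ≤
      k * meanIncrement M g (t • v) + 2 * D := by
    intro k hk
    have h1 := (meanIncrement_subadditive hM hf v).lim_le_div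
      (bddBelow_meanIncrement_div hM hf v) (mul_ne_zero hk ht)
    rw [le_div_iff₀ (by positivity)] at h1
    have h2 : meanIncrement M f (k • t • v) ≤ meanIncrement M g (k • t • v) + 2 * D := by
      have h3 := hM.map_add _ _ (hg.isBddFun (k • t • v)) (isBddFun_const (2 * D))
      rw [hM.map_const] at h3
      unfold meanIncrement
      rw [← h3]
      refine hM.mono _ _ (hf.isBddFun _) ((hg.isBddFun _).add (isBddFun_const _)) fun x => ?_
      have e : f (x + k • t • v) - f x = (g (x + k • t • v) - g x) -
          (g (x + k • t • v) - f (x + k • t • v)) + (g x - f x) := by abel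
      rw [e]
      have n1 := norm_add_le ((g (x + k • t • v) - g x) -
          (g (x + k • t • v) - f (x + k • t • v))) (g x - f x)
      have n2 := norm_sub_le (g (x + k • t • v) - g x)
          (g (x + k • t • v) - f (x + k • t • v))
      linarith [hD x, hD (x + k • t • v)]
    have h4 := meanIncrement_nsmul_le hM hg k (t • v)
    rw [smul_smul] at h2 h4
    push_cast at h1
    linarith
  by_contra! hlt
  obtain ⟨k, hk⟩ := exists_nat_gt (2 * D / ((meanIncrement_subadditive hM hf v).lim * t -
    meanIncrement M g (t • v)))
  rw [div_lt_iff₀ (sub_pos.2 hlt)] at hk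
  have hD0 : 0 ≤ D := (norm_nonneg _).trans (hD 0)
  have hk0 : k ≠ 0 := by
    rintro rfl
    simp at hk
    linarith
  linarith [key k hk0]

end Increments

section Smoothing

/-- The additive map on `ℤ^ι` with prescribed values on the standard basis. -/
def latticeHom {ι Y : Type*} [Fintype ι] [AddCommGroup Y] (d : ι → Y) : (ι → ℤ) →+ Y where
  toFun v := ∑ i, v i • d i
  map_zero' := by simp
  map_add' v w := by simp [add_smul, Finset.sum_add_distrib]

theorem latticeHom_apply {ι Y : Type*} [Fintype ι] [AddCommGroup Y] (d : ι → Y)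
    (v : ι → ℤ) : latticeHom d v = ∑ i, v i • d i := rfl

variable {ι : Type*} [Fintype ι] {Y : Type} [NormedAddCommGroup Y] [NormedSpace ℝ Y]

/-- The convolution of `f` with the uniform measure on a box. -/
def boxSmooth (R : ℕ) (f : (ι → ℤ) → Y) (x : ι → ℤ) : Y := boxAvg R fun y => f (x + y)

theorem boxSmooth_increment (R : ℕ) (f : (ι → ℤ) → Y) (x v : ι → ℤ) :
    boxSmooth R f (x + v) - boxSmooth R f x = boxAvg R fun y => f (x + y + v) - f (x + y) := by
  simp only [boxSmooth, add_right_comm x v, boxAvg_sub]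

theorem BddIncrements.boxSmooth {f : (ι → ℤ) → Y} (hf : BddIncrements f) (R : ℕ) :
    BddIncrements (boxSmooth R f) := by
  intro v
  obtain ⟨B, hB⟩ := hf v
  refine ⟨B, fun x => ?_⟩
  rw [boxSmooth_increment]
  exact norm_boxAvg_le_of_le R fun y => hB _

theorem exists_norm_boxSmooth_sub_le {f : (ι → ℤ) → Y} (hf : BddIncrements f) (R : ℕ) :
    ∃ D, ∀ x, ‖boxSmooth R f x - f x‖ ≤ D := by
  choose B hB using hf
  refine ⟨boxAvg R B, fun x => ?_⟩
  have : boxSmooth R f x - f x = boxAvg R fun y => f (x + y) - f x := by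
    rw [boxAvg_sub, boxAvg_const, boxSmooth]
  rw [this]
  exact (norm_boxAvg_le R _).trans (boxAvg_mono R fun y => hB y x)

theorem eventually_boxSmooth_increment_shift {f : (ι → ℤ) → Y} (hf : BddIncrements f)
    (v w : ι → ℤ) {ε : ℝ} (hε : 0 < ε) :
    ∀ᶠ R in atTop, ∀ x, ‖(boxSmooth R f (x + v + w) - boxSmooth R f (x + v)) -
      (boxSmooth R f (x + w) - boxSmooth R f x)‖ ≤ ε := by
  obtain ⟨B, hB⟩ := hf w
  obtain ⟨δ, hδ, h⟩ := exists_boxAvg_shift_le v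
  have hlim : Tendsto (fun R => B * δ R) atTop (𝓝 0) := by simpa using hδ.const_mul B
  filter_upwards [hlim.eventually (ge_mem_nhds hε)] with R hR x
  have := h Y (fun y => f (x + y + w) - f (x + y)) B (fun y => hB _) R
  rw [boxSmooth_increment, boxSmooth_increment]
  refine le_trans (le_of_eq ?_) (this.trans hR)
  simp only [add_assoc, add_comm v]

/-- At large scales the smoothing of a function with bounded increments is locally almost
additive, uniformly over the lattice. -/
theorem eventually_boxSmooth_almost_additive {f : (ι → ℤ) → Y} (hf : BddIncrements f)
    [DecidableEq ι] (w : ι → ℤ) : ∀ ε : ℝ, 0 < ε →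
    ∀ᶠ R in atTop, ∀ x, ‖boxSmooth R f (x + w) - boxSmooth R f x - latticeHom
      (fun i => boxSmooth R f (x + Pi.single i 1) - boxSmooth R f x) w‖ ≤ ε := by
  let H : AddSubgroup (ι → ℤ) :=
    { carrier := {w | ∀ ε : ℝ, 0 < ε →
        ∀ᶠ R in atTop, ∀ x, ‖boxSmooth R f (x + w) - boxSmooth R f x - latticeHom
          (fun i => boxSmooth R f (x + Pi.single i 1) - boxSmooth R f x) w‖ ≤ ε}
      zero_mem' := by
        intro ε hε
        exact Eventually.of_forall fun R x => by simpa using hε.le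
      add_mem' := by
        intro w w' hw hw' ε hε
        have hε' : 0 < ε / 3 := by positivity
        filter_upwards [hw _ hε', hw' _ hε',
          eventually_boxSmooth_increment_shift hf w' w hε'] with R h1 h2 h3 x
        rw [map_add, add_comm w w', ← add_assoc]
        refine le_trans (le_of_eq ?_) ((norm_add₃_le).trans
          (add_le_add (add_le_add (h3 x) (h1 x)) (h2 x)) |>.trans_eq (by ring))
        congr 1
        abel
      neg_mem' := by
        intro w hw ε hε
        have hε' : 0 < ε / 2 := by positivity
        filter_upwards [hw _ hε', eventually_boxSmooth_increment_shift hf (-w) w hε']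
          with R h1 h2 x
        have h2' := h2 x
        rw [neg_add_cancel_right] at h2'
        rw [map_neg, ← norm_neg]
        refine le_trans (le_of_eq ?_) ((norm_add_le _ _).trans
          (add_le_add h2' (h1 x)) |>.trans_eq (by ring))
        congr 1
        abel }
  have hsingle : ∀ i, Pi.single i 1 ∈ H := by
    intro i ε hε
    refine Eventually.of_forall fun R x => ?_
    have : latticeHom (fun i => boxSmooth R f (x + Pi.single i 1) - boxSmooth R f x)
        (Pi.single i 1) = boxSmooth R f (x + Pi.single i 1) - boxSmooth R f x := by
      rw [latticeHom_apply, Finset.sum_eq_single i] <;> simp +contextual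
    rw [this, sub_self, norm_zero]
    exact hε.le
  suffices w ∈ H from this
  rw [pi_eq_sum_univ' w]
  refine sum_mem fun i _ => ?_
  convert zsmul_mem (hsingle i) (w i) using 1

/-- A coarse bi-Lipschitz map from a lattice to a normed space can be linearized along any finite
set of directions, with essentially the same constants. -/
theorem exists_addMonoidHom_of_coarse_lipschitz {f : (ι → ℤ) → Y} {q : (ι → ℤ) → ℝ}
    (hq : ∀ (t : ℕ) v, q (t • v) = t * q v) {c L B : ℝ}
    (hfL : ∀ x v, ‖f (x + v) - f x‖ ≤ L * q v + B)
    (hfc : ∀ x v, c * q v - B ≤ ‖f (x + v) - f x‖)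
    (U : Finset (ι → ℤ)) {ε : ℝ} (hε : 0 < ε) :
    ∃ D : (ι → ℤ) →+ Y, ∀ u ∈ U, c * q u - ε ≤ ‖D u‖ ∧ ‖D u‖ ≤ L * q u + ε := by
  classical
  have hf : BddIncrements f := fun v => ⟨_, fun x => hfL x v⟩
  obtain ⟨M, hM⟩ := exists_isInvariantMean ι
  let σ : (ι → ℤ) → ℝ := fun u => (meanIncrement_subadditive hM hf u).lim
  let δ : ℝ := ε / (4 * (U.card + 1))
  have hδ : 0 < δ := by positivity
  obtain ⟨t, ht, htB, ht0⟩ : ∃ t : ℕ, (∀ u ∈ U, meanIncrement M f (t • u) / t ≤ σ u + δ) ∧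
      B / t ≤ ε / 4 ∧ 0 < t := by
    refine Eventually.exists (f := atTop) ?_
    refine ((eventually_all_finset U).2 fun u _ => ?_).and
      (Eventually.and ?_ (eventually_gt_atTop 0))
    · exact ((meanIncrement_subadditive hM hf u).tendsto_lim
        (bddBelow_meanIncrement_div hM hf u)).eventually (ge_mem_nhds (lt_add_of_pos_right _ hδ))
    · exact (tendsto_const_div_atTop_nhds_zero_nat B).eventually (ge_mem_nhds (by positivity))
  have ht0' : (0 : ℝ) < t := by exact_mod_cast ht0
  rw [div_le_iff₀ ht0'] at htB
  obtain ⟨R, hR⟩ := ((eventually_all_finset U).2 fun u _ =>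
    eventually_boxSmooth_almost_additive hf (t • u) (ε / 4 * t) (by positivity)).exists
  obtain ⟨D, hD⟩ := exists_norm_boxSmooth_sub_le hf R
  have hg := hf.boxSmooth R
  let ψ : (ι → ℤ) → (ι → ℤ) → ℝ := fun u x =>
    boxAvg R (fun y => ‖f (x + y + t • u) - f (x + y)‖) -
      ‖boxSmooth R f (x + t • u) - boxSmooth R f x‖
  have hψ0 : ∀ u x, 0 ≤ ψ u x := fun u x => by
    rw [sub_nonneg, boxSmooth_increment]
    exact norm_boxAvg_le R _
  have hbdd : ∀ u, IsBddFun fun x => boxAvg R (fun y => ‖f (x + y + t • u) - f (x + y)‖) := by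
    intro u
    obtain ⟨K, hK⟩ := hf (t • u)
    exact ⟨K, fun x => norm_boxAvg_le_of_le R fun y => (norm_norm _).trans_le (hK (x + y))⟩
  have hψb : ∀ u, IsBddFun (ψ u) := fun u => by
    simpa [ψ, sub_eq_add_neg] using (hbdd u).add ((hg.isBddFun (t • u)).const_mul (-1))
  have hψM : ∀ u ∈ U, M (ψ u) ≤ t * δ := by
    intro u hu
    have h1 := hM.map_sub (hbdd u) (hg.isBddFun (t • u))
    have h2 := hM.map_boxAvg (hf.isBddFun (t • u)) R
    have h3 : σ u * t ≤ _ := lim_mul_le_meanIncrement hM hf hg hD u t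
    have h4 := ht u hu
    rw [div_le_iff₀ ht0'] at h4
    rw [h2] at h1
    unfold meanIncrement at h3 h4
    simp only [ψ]
    rw [h1]
    linarith
  obtain ⟨x, hx⟩ : ∃ x, ∑ u ∈ U, ψ u x < ε / 4 * t := by
    refine hM.exists_lt (IsBddFun.sum U hψb) ?_
    rw [hM.map_sum U hψb]
    refine (Finset.sum_le_sum hψM).trans_lt ?_
    have : (U.card + 1) * δ = ε / 4 := by simp only [δ]; field_simp
    rw [Finset.sum_const, nsmul_eq_mul, ← this]
    nlinarith [mul_pos ht0' hδ]
  refine ⟨latticeHom fun i => boxSmooth R f (x + Pi.single i 1) - boxSmooth R f x,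
    fun u hu => ?_⟩
  have h1 := hR u hu x
  rw [map_nsmul] at h1
  set d := latticeHom (fun i => boxSmooth R f (x + Pi.single i 1) - boxSmooth R f x) u
  set e := boxSmooth R f (x + t • u) - boxSmooth R f x with he
  have hd : ‖t • d‖ = t * ‖d‖ := by
    rw [← Nat.cast_smul_eq_nsmul ℝ, norm_smul, Real.norm_natCast]
  have hux : ψ u x < ε / 4 * t :=
    (Finset.single_le_sum (fun u _ => hψ0 u x) hu).trans_lt hx
  have hlow : c * q (t • u) - B ≤ boxAvg R (fun y => ‖f (x + y + t • u) - f (x + y)‖) := by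
    rw [← boxAvg_const (ι := ι) R (c * q (t • u) - B)]
    exact boxAvg_mono R fun y => hfc _ _
  have hup : ‖e‖ ≤ L * q (t • u) + B := by
    rw [he, boxSmooth_increment]
    exact norm_boxAvg_le_of_le R fun y => hfL _ _
  have hψe : ψ u x = boxAvg R (fun y => ‖f (x + y + t • u) - f (x + y)‖) - ‖e‖ := rfl
  rw [hq] at hlow hup
  have h2 := norm_sub_norm_le e (t • d)
  have h3 := norm_sub_norm_le (t • d) e
  rw [norm_sub_rev (t • d) e] at h3
  rw [hd] at h2 h3
  constructor
  · refine le_of_mul_le_mul_left ?_ ht0'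
    nlinarith
  · refine le_of_mul_le_mul_left ?_ ht0'
    nlinarith

end Smoothing

section FiniteDimensional

/-- A uniformly continuous map on a normed space is Lipschitz at large distances. -/
theorem UniformContinuous.exists_norm_sub_le {X Y : Type*} [NormedAddCommGroup X]
    [NormedSpace ℝ X] [NormedAddCommGroup Y] {h : X → Y} (hh : UniformContinuous h) :
    ∃ L : ℝ, 0 < L ∧ ∀ x y, ‖h x - h y‖ ≤ L * ‖x - y‖ + 1 := by
  obtain ⟨δ, hδ, hd⟩ := Metric.uniformContinuous_iff.1 hh 1 one_pos
  have chain : ∀ n : ℕ, ∀ x y, dist x y < (n + 1) * δ → dist (h x) (h y) ≤ n + 1 := by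
    intro n
    induction n with
    | zero =>
      intro x y hxy
      simpa using (hd (by simpa using hxy)).le
    | succ n ih =>
      intro x y hxy
      push_cast at hxy ⊢
      have hn : (0 : ℝ) < n + 1 + 1 := by positivity
      let z := AffineMap.lineMap x y (1 / ((n : ℝ) + 1 + 1))
      have h1 : dist x z < δ := by
        simp only [z]
        rw [dist_left_lineMap, Real.norm_of_nonneg (by positivity), one_div,
          inv_mul_lt_iff₀ hn]
        exact hxy
      have h2 : dist z y < (n + 1) * δ := by
        simp only [z]
        have e : 1 - 1 / ((n : ℝ) + 1 + 1) = (n + 1) / (n + 1 + 1) := by field_simp; ring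
        rw [dist_lineMap_right, e, Real.norm_of_nonneg (by positivity), div_mul_eq_mul_div,
          div_lt_iff₀ hn, mul_assoc]
        refine mul_lt_mul_of_pos_left ?_ (by positivity)
        linarith
      linarith [dist_triangle (h x) (h z) (h y), hd h1, ih z y h2]
  refine ⟨δ⁻¹, inv_pos.2 hδ, fun x y => ?_⟩
  rw [← dist_eq_norm, ← dist_eq_norm, inv_mul_eq_div]
  have h1 := chain ⌊dist x y / δ⌋₊ x y ((div_lt_iff₀ hδ).1 (Nat.lt_floor_add_one _))
  have h2 := Nat.floor_le (a := dist x y / δ) (by positivity)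
  linarith

/-- A finite-dimensional normed space which embeds in a coarse bi-Lipschitz way into a normed space
embeds linearly, with comparable constants. -/
theorem exists_clm_of_coarse_lipschitz {F : Type*} {Y : Type} [NormedAddCommGroup F]
    [NormedSpace ℝ F] [FiniteDimensional ℝ F] [NormedAddCommGroup Y] [NormedSpace ℝ Y] {h : F → Y}
    {c L B : ℝ} (hc : 0 < c) (hL : 0 < L) (hhL : ∀ x y, ‖h x - h y‖ ≤ L * ‖x - y‖ + B)
    (hhc : ∀ x y, c * ‖x - y‖ - B ≤ ‖h x - h y‖) :
    ∃ T : F →L[ℝ] Y, ∀ x, c / 2 * ‖x‖ ≤ ‖T x‖ ∧ ‖T x‖ ≤ 2 * L * ‖x‖ := by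
  classical
  let b := Module.finBasis ℝ F
  let j : (Fin (Module.finrank ℝ F) → ℤ) →+ F := latticeHom b
  have hj : ∀ v, j v = ∑ i, v i • b i := latticeHom_apply _
  let K := ∑ i, ‖b i‖
  have hK : 0 ≤ K := Finset.sum_nonneg fun _ _ => norm_nonneg _
  have hround : ∀ x, ‖x - j fun i => ⌊b.repr x i⌋‖ ≤ K := by
    intro x
    have e : x - j (fun i => ⌊b.repr x i⌋) = ∑ i, Int.fract (b.repr x i) • b i := by
      conv_lhs => rw [← b.sum_repr x]
      rw [hj, ← Finset.sum_sub_distrib]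
      refine Finset.sum_congr rfl fun i _ => ?_
      rw [b.sum_repr x, Int.fract, sub_smul, Int.cast_smul_eq_zsmul]
    rw [e]
    refine norm_sum_le_of_le _ fun i _ => ?_
    rw [norm_smul, Real.norm_of_nonneg (Int.fract_nonneg _)]
    exact mul_le_of_le_one_left (norm_nonneg _) (Int.fract_lt_one _).le
  obtain ⟨N, hN4, hNL, hNc⟩ : ∃ N : ℝ, 4 * K ≤ N ∧ 4 / L ≤ N ∧
      2 * (c * K + 1 + 2 * L * K) / c ≤ N :=
    ⟨max (4 * K) (max (4 / L) (2 * (c * K + 1 + 2 * L * K) / c)), le_max_left _ _,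
      (le_max_left _ _).trans (le_max_right _ _), (le_max_right _ _).trans (le_max_right _ _)⟩
  have hN : 0 < N := (by positivity : (0 : ℝ) < 4 / L).trans_le hNL
  rw [div_le_iff₀ hL] at hNL
  rw [div_le_iff₀ hc] at hNc
  obtain ⟨m, hm⟩ : ∃ m : ℤ, ∀ x : F, ‖x‖ = N → ∀ i, |⌊b.repr x i⌋| ≤ m := by
    let Φ : F →L[ℝ] (Fin (Module.finrank ℝ F) → ℝ) :=
      LinearMap.toContinuousLinearMap (b.equivFun : F →ₗ[ℝ] _)
    refine ⟨⌈‖Φ‖ * N⌉ + 1, fun x hx i => ?_⟩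
    have h1 : |b.repr x i| ≤ ‖Φ‖ * N := by
      rw [← hx]
      exact (norm_le_pi_norm (Φ x) i).trans (Φ.le_opNorm x)
    have h2 := abs_le.1 (h1.trans (Int.le_ceil _))
    rw [abs_le]
    constructor
    · rw [Int.le_floor]
      push_cast
      linarith
    · have := Int.floor_le (b.repr x i)
      have : ((⌊b.repr x i⌋ : ℤ) : ℝ) ≤ ((⌈‖Φ‖ * N⌉ + 1 : ℤ) : ℝ) := by
        push_cast
        linarith
      exact_mod_cast this
  obtain ⟨D, hD⟩ := exists_addMonoidHom_of_coarse_lipschitz (f := fun v => h (j v))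
    (q := fun v => ‖j v‖) (c := c) (L := L) (B := B)
    (fun t v => by
      rw [map_nsmul, ← Nat.cast_smul_eq_nsmul ℝ, norm_smul, Real.norm_natCast])
    (fun x v => by simpa using hhL (j (x + v)) (j x))
    (fun x v => by simpa using hhc (j (x + v)) (j x))
    (Fintype.piFinset fun _ => Finset.Icc (-m) m) one_pos
  let T : F →L[ℝ] Y := LinearMap.toContinuousLinearMap
    (b.constr ℝ fun i => D (Pi.single i 1))
  have hTj : ∀ v, T (j v) = D v := by
    intro v
    conv_rhs => rw [pi_eq_sum_univ' v]
    rw [hj, map_sum, map_sum]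
    refine Finset.sum_congr rfl fun i _ => ?_
    rw [map_zsmul, map_zsmul]
    simp [T]
  have hT : ∀ x : F, ‖x‖ = N → c * (N - K) - 1 - ‖T‖ * K ≤ ‖T x‖ ∧
      ‖T x‖ ≤ L * (N + K) + 1 + ‖T‖ * K := by
    intro x hx
    let v : Fin (Module.finrank ℝ F) → ℤ := fun i => ⌊b.repr x i⌋
    have hv : v ∈ Fintype.piFinset fun _ => Finset.Icc (-m) m := by
      rw [Fintype.mem_piFinset]
      exact fun i => Finset.mem_Icc.2 (abs_le.1 (hm x hx i))
    obtain ⟨h1, h2⟩ := hD v hv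
    rw [← hTj] at h1 h2
    have h3 : ‖x - j v‖ ≤ K := hround x
    have h4 : ‖T x - T (j v)‖ ≤ ‖T‖ * K := by
      rw [← map_sub]
      exact (T.le_opNorm _).trans (mul_le_mul_of_nonneg_left h3 (norm_nonneg _))
    have h5 := norm_sub_norm_le x (j v)
    have h6 := norm_sub_norm_le (j v) x
    have h7 := norm_sub_norm_le (T x) (T (j v))
    have h8 := norm_sub_norm_le (T (j v)) (T x)
    rw [norm_sub_rev (j v) x] at h6
    rw [norm_sub_rev (T (j v)) (T x)] at h8
    have h9 : c * (N - K) ≤ c * ‖j v‖ := mul_le_mul_of_nonneg_left (by linarith) hc.le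
    have h10 : L * ‖j v‖ ≤ L * (N + K) := mul_le_mul_of_nonneg_left (by linarith) hL.le
    constructor <;> linarith
  have hscale : ∀ x : F, x ≠ 0 → ∃ y : F, ‖y‖ = N ∧ ‖T y‖ * ‖x‖ = N * ‖T x‖ := by
    intro x hx
    have hx' := norm_pos_iff.2 hx
    refine ⟨(N / ‖x‖) • x, ?_, ?_⟩
    · rw [norm_smul, Real.norm_of_nonneg (by positivity), div_mul_cancel₀ _ hx'.ne']
    · rw [map_smul, norm_smul, Real.norm_of_nonneg (by positivity)]
      field_simp
  have hnorm : ‖T‖ ≤ 2 * L := by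
    have h1 : ‖T‖ ≤ (L * (N + K) + 1 + ‖T‖ * K) / N := by
      refine T.opNorm_le_bound (by positivity) fun x => ?_
      rcases eq_or_ne x 0 with rfl | hx
      · simp
      obtain ⟨y, hy, hyx⟩ := hscale x hx
      rw [div_mul_eq_mul_div, le_div_iff₀ hN, mul_comm, ← hyx]
      exact mul_le_mul_of_nonneg_right (hT y hy).2 (norm_nonneg _)
    rw [le_div_iff₀ hN] at h1
    by_contra! hlt
    nlinarith
  refine ⟨T, fun x => ⟨?_, T.le_of_opNorm_le hnorm x⟩⟩
  rcases eq_or_ne x 0 with rfl | hx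
  · simp
  obtain ⟨y, hy, hyx⟩ := hscale x hx
  have h1 := (hT y hy).1
  have h2 : ‖T‖ * K ≤ 2 * L * K := mul_le_mul_of_nonneg_right hnorm hK
  have h3 : N * (c / 2) ≤ ‖T y‖ := by linarith
  refine le_of_mul_le_mul_left ?_ hN
  rw [← hyx, ← mul_assoc]
  exact mul_le_mul_of_nonneg_right h3 (norm_nonneg _)

end FiniteDimensional

/-- A normed space is crudely finitely representable in every uniformly homeomorphic one. -/
theorem crudelyFinitelyRepresentable_of_uniformHomeo {Z Y : Type} [NormedAddCommGroup Z]
    [NormedSpace ℝ Z] [NormedAddCommGroup Y] [NormedSpace ℝ Y]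
    (h : Z ≃ Y) (h₁ : UniformContinuous h) (h₂ : UniformContinuous h.symm) :
    CrudelyFinitelyRepresentable Z Y := by
  obtain ⟨L, hL, hhL⟩ := h₁.exists_norm_sub_le
  obtain ⟨L', hL', hhL'⟩ := h₂.exists_norm_sub_le
  let c := L'⁻¹
  have hc : 0 < c := inv_pos.2 hL'
  let B := max 1 c
  have hhc : ∀ x y, c * ‖x - y‖ - B ≤ ‖h x - h y‖ := by
    intro x y
    have h1 := hhL' (h x) (h y)
    rw [h.symm_apply_apply, h.symm_apply_apply] at h1
    have h2 := mul_le_mul_of_nonneg_left h1 hc.le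
    rw [mul_add, ← mul_assoc, inv_mul_cancel₀ hL'.ne'] at h2
    linarith [le_max_right 1 c]
  refine ⟨max 1 (2 * L * (c / 2)⁻¹), le_max_left _ _, fun F hF => ?_⟩
  obtain ⟨T, hT⟩ := exists_clm_of_coarse_lipschitz (F := F) (h := fun x => h x) (B := B) hc hL
    (fun x y => (hhL x y).trans (add_le_add_right (le_max_left 1 c) _)) (fun x y => hhc x y)
  have hinj : Function.Injective (T : F →ₗ[ℝ] Y) := by
    refine (injective_iff_map_eq_zero _).2 fun x hx => ?_
    have h1 := (hT x).1
    rw [show T x = 0 from hx, norm_zero] at h1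
    exact norm_le_zero_iff.1 (nonpos_of_mul_nonpos_right h1 (by positivity))
  let e : F ≃L[ℝ] LinearMap.range (T : F →ₗ[ℝ] Y) :=
    (LinearEquiv.ofInjective (T : F →ₗ[ℝ] Y) hinj).toContinuousLinearEquiv
  have he : ∀ x, ‖e x‖ = ‖T x‖ := fun x => rfl
  refine ⟨_, inferInstance, e, le_trans ?_ (le_max_right _ _)⟩
  refine mul_le_mul (ContinuousLinearMap.opNorm_le_bound _ (by positivity) fun x => ?_)
    (ContinuousLinearMap.opNorm_le_bound _ (by positivity) fun y => ?_)
    (ContinuousLinearMap.opNorm_nonneg _) (by positivity)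
  · exact (he x).trans_le (hT x).2
  · have h1 := (hT (e.symm y)).1
    rw [← he, e.apply_symm_apply] at h1
    rwa [inv_mul_eq_div, le_div_iff₀ (by positivity), mul_comm]

/-- Ribe's theorem: uniformly homeomorphic Banach spaces are crudely finitely
representable in each other. -/
theorem ribe_theorem (Z Y : Type) [NormedAddCommGroup Z] [NormedSpace ℝ Z] [CompleteSpace Z]
    [NormedAddCommGroup Y] [NormedSpace ℝ Y] [CompleteSpace Y]
    (h : Z ≃ Y) (h₁ : UniformContinuous h) (h₂ : UniformContinuous h.symm) :
    CrudelyFinitelyRepresentable Z Y ∧ CrudelyFinitelyRepresentable Y Z := by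
  exact ⟨crudelyFinitelyRepresentable_of_uniformHomeo h h₁ h₂,
    crudelyFinitelyRepresentable_of_uniformHomeo h.symm h₂ (by simpa using h₁)⟩
end
end

section
/- A Banach space Y is superreflexive if and only if there exist q ∈ [2,∞), a constant c > 0, and an equivalent norm |||·||| on Y such that for all x, y with |||x||| ≤ 1, |||y||| ≤ 1 and all ε ∈ (0,2] with |||x − y||| ≥ ε one has |||(x+y)/2||| ≤ 1 − c·ε^q (i.e., Y admits an equivalent q-convex norm). -/
noncomputable section

/-- `X` is finitely representable in `Y`. -/
def FinitelyRepresentable (X Y : Type) [NormedAddCommGroup X] [NormedSpace ℝ X]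
    [NormedAddCommGroup Y] [NormedSpace ℝ Y] : Prop :=
  ∀ ε : ℝ, 0 < ε → ∀ F : Submodule ℝ X, FiniteDimensional ℝ F →
    ∃ G : Submodule ℝ Y, FiniteDimensional ℝ G ∧
      ∃ T : F ≃L[ℝ] G, ‖(T : F →L[ℝ] G)‖ * ‖(T.symm : G →L[ℝ] F)‖ ≤ 1 + ε

/-- A Banach space is reflexive if the canonical embedding into the double dual is
surjective. -/
def IsReflexiveBanach (X : Type) [NormedAddCommGroup X] [NormedSpace ℝ X] : Prop :=
  Function.Surjective (NormedSpace.inclusionInDoubleDual ℝ X)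

/-- `Y` is superreflexive: every Banach space finitely representable in `Y` is reflexive. -/
def SuperReflexive (Y : Type) [NormedAddCommGroup Y] [NormedSpace ℝ Y] : Prop :=
  ∀ (X : Type) [NormedAddCommGroup X] [NormedSpace ℝ X] [CompleteSpace X],
    FinitelyRepresentable X Y → IsReflexiveBanach X

section SeparatedSequences

open NormedSpace

/-- Helly's lemma (approximate form): finitely many values of a bidual functional of norm at most
one are approximated by evaluation at a point of the unit ball. -/
theorem exists_mem_ball_approx_bidual {E : Type} [NormedAddCommGroup E] [NormedSpace ℝ E]
    {ι : Type} [Fintype ι] (Φ : StrongDual ℝ (StrongDual ℝ E)) (hΦ : ‖Φ‖ ≤ 1)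
    (f : ι → StrongDual ℝ E) {η : ℝ} (hη : 0 < η) :
    ∃ x : E, ‖x‖ ≤ 1 ∧ ∀ i, |f i x - Φ (f i)| ≤ η := by
  classical
  set T : E →L[ℝ] (ι → ℝ) := ContinuousLinearMap.pi f with hT
  set S : Set (ι → ℝ) := closure (T '' Metric.closedBall 0 1) with hS
  by_cases hv : (fun i => Φ (f i)) ∈ S
  · obtain ⟨_, ⟨x, hx, rfl⟩, hd⟩ := Metric.mem_closure_iff.1 hv η hη
    refine ⟨x, by simpa using hx, fun i => ?_⟩
    have := (dist_le_pi_dist _ _ i).trans hd.le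
    rw [Real.dist_eq, abs_sub_comm] at this
    simpa [hT] using this
  · exfalso
    have hconv : Convex ℝ S :=
      ((convex_closedBall (0 : E) 1).linear_image T.toLinearMap).closure
    obtain ⟨ℓ, u, hu, huv⟩ := geometric_hahn_banach_closed_point hconv isClosed_closure hv
    have hu0 : 0 < u := by
      have := hu 0 (subset_closure ⟨0, by simp, by simp⟩)
      simpa using this
    have hle : ‖ℓ.comp T‖ ≤ u := by
      refine ContinuousLinearMap.opNorm_le_of_unit_norm hu0.le fun x hx => ?_
      have h1 := hu (T x) (subset_closure ⟨x, by simp [hx], rfl⟩)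
      have h2 := hu (T (-x)) (subset_closure ⟨-x, by simp [hx], rfl⟩)
      rw [map_neg, map_neg] at h2
      rw [ContinuousLinearMap.comp_apply, Real.norm_eq_abs]
      exact abs_le.2 ⟨by linarith, h1.le⟩
    have hsum : ∀ v : ι → ℝ, ℓ v = ∑ i, v i * ℓ (Pi.single i 1) := by
      intro v
      conv_lhs => rw [pi_eq_sum_univ' v]
      simp
    have hcomp : ℓ.comp T = ∑ i, ℓ (Pi.single i 1) • f i := by
      ext x
      have := hsum (T x)
      simpa [hT, mul_comm] using this
    have hval : ℓ (fun i => Φ (f i)) = Φ (ℓ.comp T) := by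
      rw [hcomp, hsum]
      simp [mul_comm]
    have := Φ.le_of_opNorm_le hΦ (ℓ.comp T)
    rw [← hval, Real.norm_eq_abs, one_mul] at this
    linarith [le_abs_self (ℓ (fun i => Φ (f i)))]

/-- A linear isometry from a Banach space that is not surjective has a range which is annihilated
by a norm-one functional that is large at a point of the unit ball. -/
theorem exists_dual_annihilating_range {E F : Type*} [NormedAddCommGroup E] [NormedSpace ℝ E]
    [CompleteSpace E] [NormedAddCommGroup F] [NormedSpace ℝ F] (i : E →ₗᵢ[ℝ] F)
    (hi : ¬ Function.Surjective i) :
    ∃ (Φ : F) (G : StrongDual ℝ F), ‖Φ‖ ≤ 1 ∧ ‖G‖ ≤ 1 ∧ (∀ x, G (i x) = 0) ∧ 3 / 4 ≤ G Φ := by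
  set R : Submodule ℝ F := LinearMap.range i.toLinearMap with hR
  have hcl : IsClosed (R : Set F) := by
    have h := i.isometry.isUniformInducing.isComplete_range
    simpa [hR, LinearMap.coe_range] using h.isClosed
  have hne : ∃ Ψ, Ψ ∉ R := by
    by_contra! h
    exact hi fun Ψ => by
      obtain ⟨x, hx⟩ := h Ψ
      exact ⟨x, hx⟩
  obtain ⟨Ψ, hΨR, hΨ⟩ := riesz_lemma hcl hne (r := 3 / 4) (by norm_num)
  have hΨ0 : 0 < ‖Ψ‖ := norm_pos_iff.2 fun h => hΨR (h ▸ R.zero_mem)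
  obtain ⟨g, hg1, hg⟩ := exists_dual_vector'' ℝ (R.mkQ Ψ)
  set G : StrongDual ℝ F :=
    LinearMap.mkContinuous (g.toLinearMap ∘ₗ R.mkQ) 1 (fun Θ => by
      rw [one_mul]
      calc ‖g (R.mkQ Θ)‖ ≤ 1 * ‖R.mkQ Θ‖ := g.le_of_opNorm_le hg1 _
        _ ≤ ‖Θ‖ := by rw [one_mul]; exact Submodule.Quotient.norm_mk_le R Θ) with hG
  have hGX : ∀ x, G (i x) = 0 := by
    intro x
    have : R.mkQ (i x) = 0 := by
      rw [Submodule.mkQ_apply, Submodule.Quotient.mk_eq_zero]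
      exact ⟨x, rfl⟩
    simp only [hG, LinearMap.mkContinuous_apply, LinearMap.comp_apply, this]
    simp
  have hGΨ : 3 / 4 * ‖Ψ‖ ≤ G Ψ := by
    have h1 : G Ψ = ‖R.mkQ Ψ‖ := by simpa [hG] using hg
    rw [h1, Submodule.mkQ_apply]
    refine le_of_not_gt fun hlt => ?_
    obtain ⟨m, hm, hmn⟩ := Submodule.Quotient.norm_mk_lt (S := R) (Submodule.Quotient.mk Ψ)
      (sub_pos.2 hlt)
    have hmem : Ψ - m ∈ R := (Submodule.Quotient.eq R).1 hm.symm
    have := hΨ _ hmem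
    rw [sub_sub_cancel] at this
    linarith
  refine ⟨(‖Ψ‖⁻¹ : ℝ) • Ψ, G, ?_, LinearMap.mkContinuous_norm_le _ zero_le_one _, hGX, ?_⟩
  · rw [norm_smul, norm_inv, norm_norm, inv_mul_cancel₀ hΨ0.ne']
  · rw [map_smul, smul_eq_mul, inv_mul_eq_div, le_div_iff₀ hΨ0]
    exact hGΨ

/-- In a non-reflexive Banach space, for every `n` there are `n` points of the unit ball whose
initial segments are separated from the corresponding tails by functionals of norm one. -/
theorem exists_separated_of_not_reflexive {X : Type} [NormedAddCommGroup X] [NormedSpace ℝ X]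
    [CompleteSpace X] (hX : ¬ IsReflexiveBanach X) (n : ℕ) :
    ∃ (x : ℕ → X) (f : ℕ → StrongDual ℝ X), (∀ k < n, ‖x k‖ ≤ 1) ∧ (∀ k < n, ‖f k‖ ≤ 1) ∧
      (∀ k < n, ∀ j < k, f k (x j) ≤ 1 / 8) ∧
      (∀ k < n, ∀ j < n, k ≤ j → 1 / 2 ≤ f k (x j)) := by
  obtain ⟨Φ, G, hΦ1, hG1, hGX, hGΦ⟩ :=
    exists_dual_annihilating_range (E := X) (F := StrongDual ℝ (StrongDual ℝ X))
      (inclusionInDoubleDualLi ℝ) (by exact hX)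
  replace hGX : ∀ x : X, G (inclusionInDoubleDual ℝ X x) = 0 := hGX
  suffices H : ∃ (x : ℕ → X) (f : ℕ → StrongDual ℝ X), (∀ k < n, ‖x k‖ ≤ 1) ∧
      (∀ k < n, ‖f k‖ ≤ 1) ∧ (∀ k < n, ∀ j < k, f k (x j) ≤ 1 / 8) ∧
      (∀ k < n, ∀ j < n, k ≤ j → 1 / 2 ≤ f k (x j)) ∧ (∀ k < n, 5 / 8 ≤ Φ (f k)) by
    obtain ⟨x, f, h1, h2, h3, h4, -⟩ := H
    exact ⟨x, f, h1, h2, h3, h4⟩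
  induction n with
  | zero => exact ⟨fun _ => 0, fun _ => 0, by simp⟩
  | succ n ih =>
    obtain ⟨x, f, hx, hf, hlow, hup, hΦf⟩ := ih
    obtain ⟨φ, hφ1, hφ⟩ := exists_mem_ball_approx_bidual G hG1
      (fun o : Option (Fin n) => o.elim Φ fun j => inclusionInDoubleDual ℝ X (x j))
      (η := 1 / 8) (by norm_num)
    have hφΦ : 5 / 8 ≤ Φ φ := by
      have := abs_le.1 (hφ none)
      simp only [Option.elim_none] at this
      linarith [this.1]
    have hφx : ∀ j < n, φ (x j) ≤ 1 / 8 := by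
      intro j hj
      have := abs_le.1 (hφ (some ⟨j, hj⟩))
      simp only [Option.elim_some, hGX, dual_def] at this
      linarith [this.2]
    obtain ⟨y, hy1, hy⟩ := exists_mem_ball_approx_bidual Φ hΦ1
      (fun o : Option (Fin n) => o.elim φ fun j => f j) (η := 1 / 8) (by norm_num)
    have hyφ : 1 / 2 ≤ φ y := by
      have := abs_le.1 (hy none)
      simp only [Option.elim_none] at this
      linarith [this.1]
    have hyf : ∀ k < n, 1 / 2 ≤ f k y := by
      intro k hk
      have := abs_le.1 (hy (some ⟨k, hk⟩))
      simp only [Option.elim_some] at this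
      linarith [this.1, hΦf k hk]
    refine ⟨Function.update x n y, Function.update f n φ, ?_, ?_, ?_, ?_, ?_⟩
    · intro k hk
      rcases Nat.lt_succ_iff_lt_or_eq.1 hk with h | rfl
      · simpa [h.ne] using hx k h
      · simpa using hy1
    · intro k hk
      rcases Nat.lt_succ_iff_lt_or_eq.1 hk with h | rfl
      · simpa [h.ne] using hf k h
      · simpa using hφ1
    · intro k hk j hj
      rcases Nat.lt_succ_iff_lt_or_eq.1 hk with h | rfl
      · simpa [h.ne, (hj.trans h).ne] using hlow k h j hj
      · simpa [hj.ne] using hφx j hj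
    · intro k hk j hj hkj
      rcases Nat.lt_succ_iff_lt_or_eq.1 hj with h | rfl
      · simpa [h.ne, (hkj.trans_lt h).ne] using hup k (hkj.trans_lt h) j h hkj
      · rcases hkj.lt_or_eq with h | rfl
        · simpa [h.ne] using hyf k h
        · simpa using hyφ
    · intro k hk
      rcases Nat.lt_succ_iff_lt_or_eq.1 hk with h | rfl
      · simpa [h.ne] using hΦf k h
      · simpa using hφΦ

end SeparatedSequences

section DyadicAverages

/-- Averages of a sequence over the dyadic blocks `[i * 2 ^ l, (i + 1) * 2 ^ l)`. -/
def dyadicAverage {V : Type*} [AddCommGroup V] [Module ℝ V] (x : ℕ → V) : ℕ → ℕ → V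
  | 0, i => x i
  | l + 1, i => (2⁻¹ : ℝ) • (dyadicAverage x l (2 * i) + dyadicAverage x l (2 * i + 1))

theorem dyadicAverage_mem {V : Type*} [AddCommGroup V] [Module ℝ V] {x : ℕ → V} {S : Set V}
    (hS : Convex ℝ S) (l i : ℕ) (h : ∀ j, i * 2 ^ l ≤ j → j < (i + 1) * 2 ^ l → x j ∈ S) :
    dyadicAverage x l i ∈ S := by
  induction l generalizing i with
  | zero => exact h i (by simp) (by simp)
  | succ l ih =>
    rw [dyadicAverage, smul_add]
    refine hS (ih _ fun j h1 h2 => h j ?_ ?_) (ih _ fun j h1 h2 => h j ?_ ?_)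
      (by norm_num) (by norm_num) (by norm_num)
    · rw [pow_succ]; linarith
    · rw [pow_succ]; nlinarith [Nat.zero_le (2 ^ l)]
    · rw [pow_succ]; nlinarith [Nat.zero_le (2 ^ l)]
    · rw [pow_succ]; linarith

/-- A Banach space with an equivalent uniformly convex norm of power type is superreflexive. -/
theorem superReflexive_of_q_convex {Y : Type} [NormedAddCommGroup Y] [NormedSpace ℝ Y]
    {q c A B : ℝ} (hc : 0 < c) {N : Y → ℝ}
    (hsmul : ∀ (a : ℝ) (y : Y), N (a • y) = |a| * N y)
    (hadd : ∀ y z : Y, N (y + z) ≤ N y + N z) (hA : 0 < A) (hB : 0 < B)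
    (hAN : ∀ y, A * ‖y‖ ≤ N y) (hNB : ∀ y, N y ≤ B * ‖y‖)
    (hN : ∀ x y : Y, N x ≤ 1 → N y ≤ 1 → ∀ ε : ℝ, 0 < ε → ε ≤ 2 → ε ≤ N (x - y) →
      N ((2⁻¹ : ℝ) • (x + y)) ≤ 1 - c * ε ^ q) : SuperReflexive Y := by
  intro X _ _ _ hfr
  by_contra hX
  set κ : ℝ := min (3 * A / (16 * B)) 1 with hκ
  have hκ0 : 0 < κ := lt_min (by positivity) one_pos
  have hκ1 : κ ≤ 1 := min_le_right _ _
  set r : ℝ := max (1 - c * κ ^ q) (1 / 2) with hr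
  have hr0 : 0 < r := lt_of_lt_of_le (by norm_num) (le_max_right _ _)
  have hr1 : r < 1 := max_lt (by linarith [mul_pos hc (Real.rpow_pos_of_pos hκ0 q)]) (by norm_num)
  obtain ⟨n, hn⟩ := exists_pow_lt_of_lt_one (half_pos hκ0) hr1
  obtain ⟨x, f, hx, hf, hlow, hup⟩ := exists_separated_of_not_reflexive hX (2 ^ (n + 1))
  set F : Submodule ℝ X := Submodule.span ℝ (Set.range fun j : Fin (2 ^ (n + 1)) => x j) with hF
  have hfin : FiniteDimensional ℝ F := FiniteDimensional.span_of_finite ℝ (Set.finite_range _)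
  obtain ⟨G, -, T, hT⟩ := hfr 1 one_pos F hfin
  set z : ℕ → F := fun j => if h : j < 2 ^ (n + 1) then
    ⟨x j, Submodule.subset_span ⟨⟨j, h⟩, rfl⟩⟩ else 0 with hz
  have hzx : ∀ j < 2 ^ (n + 1), (z j : X) = x j := fun j hj => by simp [hz, hj]
  set τ : ℝ := ‖(T : F →L[ℝ] G)‖ with hτ
  have hτn : 0 ≤ τ := by positivity
  set M : F → ℝ := fun v => N (T v) with hM
  have hMlow : ∀ v : F, A / 2 * τ * ‖v‖ ≤ M v := by
    intro v
    have h1 : ‖v‖ ≤ ‖(T.symm : G →L[ℝ] F)‖ * ‖T v‖ := by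
      simpa using (T.symm : G →L[ℝ] F).le_opNorm (T v)
    have h2 : τ * ‖v‖ ≤ 2 * ‖T v‖ := by
      calc τ * ‖v‖ ≤ τ * (‖(T.symm : G →L[ℝ] F)‖ * ‖T v‖) :=
            mul_le_mul_of_nonneg_left h1 hτn
        _ = (τ * ‖(T.symm : G →L[ℝ] F)‖) * ‖T v‖ := by ring
        _ ≤ 2 * ‖T v‖ := mul_le_mul_of_nonneg_right (by linarith) (norm_nonneg _)
    have h3 := hAN (T v : Y)
    rw [← Submodule.coe_norm] at h3
    simp only [hM]
    nlinarith
  have hMsmul : ∀ (a : ℝ) (v : F), M (a • v) = |a| * M v := fun a v => by simp [hM, hsmul]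
  have hsep : ∀ l ≤ n, ∀ i, (i + 1) * 2 ^ (l + 1) ≤ 2 ^ (n + 1) →
      3 / 8 ≤ ‖dyadicAverage z l (2 * i) - dyadicAverage z l (2 * i + 1)‖ := by
    intro l hl i hi
    rw [pow_succ 2 l] at hi
    have hpos : 0 < 2 ^ l := by positivity
    have hk : (2 * i + 1) * 2 ^ l < 2 ^ (n + 1) := by nlinarith
    set k := (2 * i + 1) * 2 ^ l with hkdef
    have h1 : dyadicAverage z l (2 * i) ∈ {v : F | f k v ≤ 1 / 8} := by
      refine dyadicAverage_mem (convex_halfSpace_le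
        ((f k).toLinearMap ∘ₗ F.subtype).isLinear _) _ _ fun j _ hj => ?_
      simp only [Set.mem_ofPred_eq, LinearMap.comp_apply, Submodule.subtype_apply]
      rw [hzx j (hj.trans hk)]
      exact hlow k hk j hj
    have h2 : dyadicAverage z l (2 * i + 1) ∈ {v : F | 1 / 2 ≤ f k v} := by
      refine dyadicAverage_mem (convex_halfSpace_ge
        ((f k).toLinearMap ∘ₗ F.subtype).isLinear _) _ _ fun j hj hj' => ?_
      have hjn : j < 2 ^ (n + 1) := by nlinarith
      simp only [Set.mem_ofPred_eq, LinearMap.comp_apply, Submodule.subtype_apply]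
      rw [hzx j hjn]
      exact hup k hk j hjn hj
    have h3 := (f k).le_of_opNorm_le (hf k hk)
      ((dyadicAverage z l (2 * i) - dyadicAverage z l (2 * i + 1) : F) : X)
    rw [Submodule.coe_sub, map_sub, one_mul, Real.norm_eq_abs] at h3
    have h4 := neg_abs_le (f k (dyadicAverage z l (2 * i) : F) -
      f k (dyadicAverage z l (2 * i + 1) : F))
    rw [Submodule.coe_norm, Submodule.coe_sub]
    simp only [Set.mem_ofPred_eq] at h1 h2
    linarith
  have hτ0 : 0 < τ := by
    refine lt_of_le_of_ne hτn fun h => ?_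
    have h0 := hsep 0 (Nat.zero_le _) 0 (by
      simpa using Nat.pow_le_pow_right (n := 2) (by norm_num) (Nat.succ_le_succ (Nat.zero_le n)))
    have : dyadicAverage z 0 (2 * 0) - dyadicAverage z 0 (2 * 0 + 1) = 0 := by
      apply T.injective
      rw [map_zero]
      have h1 := (T : F →L[ℝ] G).le_opNorm (dyadicAverage z 0 (2 * 0) -
        dyadicAverage z 0 (2 * 0 + 1))
      rw [← hτ, ← h, zero_mul] at h1
      exact norm_le_zero_iff.1 h1
    rw [this, norm_zero] at h0
    norm_num at h0
  have hκM : ∀ l ≤ n, ∀ i, (i + 1) * 2 ^ (l + 1) ≤ 2 ^ (n + 1) →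
      κ * (B * τ) ≤ M (dyadicAverage z l (2 * i) - dyadicAverage z l (2 * i + 1)) := by
    intro l hl i hi
    refine le_trans ?_ ((mul_le_mul_of_nonneg_left (hsep l hl i hi) (by positivity)).trans
      (hMlow _))
    calc κ * (B * τ) ≤ 3 * A / (16 * B) * (B * τ) :=
          mul_le_mul_of_nonneg_right (min_le_left _ _) (by positivity)
      _ = A / 2 * τ * (3 / 8) := by field_simp; ring
  have hdecay : ∀ l ≤ n, ∀ i, (i + 1) * 2 ^ l ≤ 2 ^ (n + 1) →
      M (dyadicAverage z l i) ≤ B * τ * r ^ l := by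
    intro l
    induction l with
    | zero =>
      intro _ i hi
      have hin : i < 2 ^ (n + 1) := by omega
      have h1 : ‖z i‖ ≤ 1 := by rw [Submodule.coe_norm, hzx i hin]; exact hx i hin
      have h2 : ‖T (z i)‖ ≤ τ := by
        simpa using (T : F →L[ℝ] G).le_of_opNorm_le_of_le le_rfl h1
      rw [Submodule.coe_norm] at h2
      simp only [dyadicAverage, pow_zero, mul_one]
      exact (hNB _).trans (mul_le_mul_of_nonneg_left h2 hB.le)
    | succ l ih =>
      intro hl i hi
      have hl' : l ≤ n := by omega
      have hi' : (i + 1) * (2 ^ l * 2) ≤ 2 ^ (n + 1) := by rwa [pow_succ] at hi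
      have ha := ih hl' (2 * i) (by nlinarith [Nat.zero_le (2 ^ l)])
      have hb := ih hl' (2 * i + 1) (by nlinarith [Nat.zero_le (2 ^ l)])
      set ρ : ℝ := B * τ * r ^ l with hρ
      have hρ0 : 0 < ρ := by positivity
      have hab : κ * ρ ≤ M (dyadicAverage z l (2 * i) - dyadicAverage z l (2 * i + 1)) := by
        refine le_trans (mul_le_mul_of_nonneg_left ?_ hκ0.le) (hκM l hl' i hi)
        exact mul_le_of_le_one_right (by positivity) (pow_le_one₀ hr0.le hr1.le)
      rw [dyadicAverage]
      generalize dyadicAverage z l (2 * i) = a at *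
      generalize dyadicAverage z l (2 * i + 1) = b at *
      have key := hN (T (ρ⁻¹ • a) : G) (T (ρ⁻¹ • b) : G) ?_ ?_ κ hκ0 (by linarith) ?_
      · have e : N ((2⁻¹ : ℝ) • ((T (ρ⁻¹ • a) : G) + (T (ρ⁻¹ • b) : G) : Y)) =
            ρ⁻¹ * M ((2⁻¹ : ℝ) • (a + b)) := by
          rw [← abs_of_pos (inv_pos.2 hρ0), ← hMsmul, abs_of_pos (inv_pos.2 hρ0)]
          simp only [hM, map_smul, map_add, Submodule.coe_smul, Submodule.coe_add]
          rw [smul_comm ρ⁻¹, smul_add ρ⁻¹]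
        rw [e] at key
        have h5 : ρ⁻¹ * M ((2⁻¹ : ℝ) • (a + b)) ≤ r := key.trans (le_max_left _ _)
        rw [inv_mul_le_iff₀ hρ0] at h5
        rw [pow_succ, ← mul_assoc]
        exact h5
      · change M (ρ⁻¹ • a) ≤ 1
        rw [hMsmul, abs_of_pos (inv_pos.2 hρ0), inv_mul_le_iff₀ hρ0, mul_one]
        exact ha
      · change M (ρ⁻¹ • b) ≤ 1
        rw [hMsmul, abs_of_pos (inv_pos.2 hρ0), inv_mul_le_iff₀ hρ0, mul_one]
        exact hb
      · have e : N ((T (ρ⁻¹ • a) : G) - (T (ρ⁻¹ • b) : G) : Y) = ρ⁻¹ * M (a - b) := by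
          rw [← abs_of_pos (inv_pos.2 hρ0), ← hMsmul, abs_of_pos (inv_pos.2 hρ0)]
          simp only [hM, map_smul, map_sub, Submodule.coe_smul, Submodule.coe_sub]
          rw [smul_sub ρ⁻¹]
        rw [e, le_inv_mul_iff₀ hρ0, mul_comm]
        exact hab
  have h1 := hdecay n le_rfl 0 (by rw [pow_succ]; omega)
  have h2 := hdecay n le_rfl 1 (by rw [pow_succ]; omega)
  have h3 := hκM n le_rfl 0 (by omega)
  have h4 : M (dyadicAverage z n 0 - dyadicAverage z n 1) ≤
      M (dyadicAverage z n 0) + M (dyadicAverage z n 1) := by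
    have e1 := hadd (T (dyadicAverage z n 0)) ((-1 : ℝ) • (T (dyadicAverage z n 1) : Y))
    rw [hsmul, abs_neg, abs_one, one_mul, neg_one_smul, ← sub_eq_add_neg] at e1
    simpa [hM] using e1
  have h5 : 0 < B * τ := by positivity
  simp only [mul_zero, zero_add] at h3
  nlinarith

end DyadicAverages

section UltrafilterLimit

open Filter Topology

/-- The limit of a real sequence along a fixed nonprincipal ultrafilter. -/
def ulim (u : ℕ → ℝ) : ℝ := limUnder (hyperfilter ℕ : Filter ℕ) u

theorem tendsto_ulim {u : ℕ → ℝ} {b : ℝ} (h : ∀ n, |u n| ≤ b) :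
    Tendsto u (hyperfilter ℕ) (𝓝 (ulim u)) := by
  have hle : ((hyperfilter ℕ).map u : Filter ℝ) ≤ 𝓟 (Set.Icc (-b) b) := by
    rw [Ultrafilter.coe_map, le_principal_iff, mem_map]
    exact univ_mem' fun n => abs_le.1 (h n)
  obtain ⟨l, -, hl⟩ := isCompact_Icc.ultrafilter_le_nhds _ hle
  exact tendsto_nhds_limUnder ⟨l, hl⟩

theorem Filter.Tendsto.ulim_eq {u : ℕ → ℝ} {l : ℝ} (h : Tendsto u (hyperfilter ℕ) (𝓝 l)) :
    ulim u = l := h.limUnder_eq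

theorem eventually_hyperfilter_of_ge {P : ℕ → Prop} (m : ℕ) (h : ∀ n, m ≤ n → P n) :
    ∀ᶠ n in (hyperfilter ℕ : Filter ℕ), P n :=
  (Nat.hyperfilter_le_atTop) ((eventually_ge_atTop m).mono h)

end UltrafilterLimit

section Ultrapower

open Filter Topology BoundedContinuousFunction

/-- A quotient of bounded sequences in `Y` whose norm is the limit of the norms of the terms is
finitely representable in `Y`. -/
theorem finitelyRepresentable_of_quotient {X Y : Type} [NormedAddCommGroup X] [NormedSpace ℝ X]
    [NormedAddCommGroup Y] [NormedSpace ℝ Y] (Q : (ℕ →ᵇ Y) →ₗ[ℝ] X)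
    (hQ : Function.Surjective Q)
    (hlim : ∀ u : ℕ →ᵇ Y, Tendsto (fun n => ‖u n‖) (hyperfilter ℕ) (𝓝 ‖Q u‖)) :
    FinitelyRepresentable X Y := by
  intro ε hε F hF
  obtain ⟨s, hs⟩ := Q.exists_rightInverse_of_surjective (LinearMap.range_eq_top.2 hQ)
  have hs' : ∀ v, Q (s v) = v := fun v => LinearMap.congr_fun hs v
  set S : F →L[ℝ] (ℕ →ᵇ Y) := LinearMap.toContinuousLinearMap (s ∘ₗ F.subtype) with hS
  have hSv : ∀ v : F, S v = s v := fun v => rfl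
  set L : ℕ → F →ₗ[ℝ] Y := fun n =>
    { toFun := fun v => S v n, map_add' := by intros; simp, map_smul' := by intros; simp } with hL
  have hLv : ∀ n v, L n v = S v n := fun _ _ => rfl
  have hLlim : ∀ v : F, Tendsto (fun n => ‖L n v‖) (hyperfilter ℕ) (𝓝 ‖v‖) := by
    intro v
    have := hlim (s v)
    rw [hs'] at this
    exact this
  have hLb : ∀ n v, ‖L n v‖ ≤ ‖S‖ * ‖v‖ := fun n v =>
    ((S v).norm_coe_le_norm n).trans (S.le_opNorm v)
  set η : ℝ := ε / (2 + ε) with hη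
  have hη0 : 0 < η := by positivity
  have hη1 : η < 1 := by rw [hη, div_lt_one (by positivity)]; linarith
  set δ : ℝ := η / (2 * (1 + ‖S‖)) with hδ
  have hδ0 : 0 < δ := by positivity
  have hδS : δ + ‖S‖ * δ ≤ η := by
    rw [hδ, div_add' _ _ _ (by positivity), div_le_iff₀ (by positivity)]
    have : ‖S‖ * (η / (2 * (1 + ‖S‖))) * (2 * (1 + ‖S‖)) = ‖S‖ * η := by field_simp
    nlinarith [norm_nonneg S]
  have := FiniteDimensional.proper ℝ F
  obtain ⟨t, hts, htf, htcov⟩ := (isCompact_sphere (0 : F) 1).finite_cover_balls hδ0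
  have hev : ∀ᶠ n in (hyperfilter ℕ : Filter ℕ), ∀ v ∈ t, |‖L n v‖ - 1| < δ := by
    rw [htf.eventually_all]
    intro v hv
    have h1 : ‖v‖ = 1 := by simpa using hts hv
    have := (hLlim v).eventually (Metric.ball_mem_nhds _ hδ0)
    simpa [h1, Real.dist_eq] using this
  obtain ⟨n, hn⟩ := hev.exists
  have hunit : ∀ v : F, ‖v‖ = 1 → |‖L n v‖ - 1| ≤ η := by
    intro v hv
    obtain ⟨w, hw, hvw⟩ := Set.mem_iUnion₂.1 (htcov (show v ∈ Metric.sphere (0 : F) 1 by simpa))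
    have h1 := hn w hw
    have h2 : |‖L n v‖ - ‖L n w‖| ≤ ‖S‖ * δ := by
      refine (abs_norm_sub_norm_le _ _).trans ?_
      rw [← map_sub]
      refine (hLb _ _).trans (mul_le_mul_of_nonneg_left ?_ (by positivity))
      rw [← dist_eq_norm]
      exact (Metric.mem_ball.1 hvw).le
    have h3 := abs_sub_le (‖L n v‖) (‖L n w‖) 1
    linarith
  have hall : ∀ v : F, |‖L n v‖ - ‖v‖| ≤ η * ‖v‖ := by
    intro v
    rcases eq_or_ne v 0 with rfl | hv
    · simp
    have hv0 : 0 < ‖v‖ := norm_pos_iff.2 hv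
    have h1 := hunit (‖v‖⁻¹ • v) (by rw [norm_smul, norm_inv, norm_norm, inv_mul_cancel₀ hv0.ne'])
    rw [map_smul, norm_smul, norm_inv, norm_norm] at h1
    have h2 : ‖L n v‖ - ‖v‖ = (‖v‖⁻¹ * ‖L n v‖ - 1) * ‖v‖ := by field_simp
    rw [h2, abs_mul, abs_of_pos hv0]
    exact mul_le_mul_of_nonneg_right h1 hv0.le
  have hlow : ∀ v, (1 - η) * ‖v‖ ≤ ‖L n v‖ := fun v => by linarith [(abs_le.1 (hall v)).1]
  have hup : ∀ v, ‖L n v‖ ≤ (1 + η) * ‖v‖ := fun v => by linarith [(abs_le.1 (hall v)).2]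
  have hinj : Function.Injective (L n) := by
    rw [injective_iff_map_eq_zero]
    intro v hv
    have := hlow v
    rw [hv, norm_zero] at this
    exact norm_le_zero_iff.1 (nonpos_of_mul_nonpos_right this (sub_pos.2 hη1))
  refine ⟨LinearMap.range (L n), inferInstance,
    (LinearEquiv.ofInjective (L n) hinj).toContinuousLinearEquiv, ?_⟩
  set T := (LinearEquiv.ofInjective (L n) hinj).toContinuousLinearEquiv with hT
  have hTv : ∀ v, ‖T v‖ = ‖L n v‖ := fun v => rfl
  have h1 : ‖(T : F →L[ℝ] LinearMap.range (L n))‖ ≤ 1 + η :=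
    ContinuousLinearMap.opNorm_le_bound _ (by positivity) fun v => by simpa [hTv] using hup v
  have h2 : ‖(T.symm : LinearMap.range (L n) →L[ℝ] F)‖ ≤ (1 - η)⁻¹ := by
    refine ContinuousLinearMap.opNorm_le_bound _ (inv_nonneg.2 (sub_pos.2 hη1).le) fun w => ?_
    obtain ⟨v, rfl⟩ := T.surjective w
    rw [inv_mul_eq_div, le_div_iff₀ (sub_pos.2 hη1), mul_comm, hTv]
    simpa using hlow v
  calc _ ≤ (1 + η) * (1 - η)⁻¹ := mul_le_mul h1 h2 (by positivity) (by positivity)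
    _ = 1 + ε := by rw [hη]; field_simp; ring

/-- The ultrapower of a Banach space, presented as a quotient of the bounded sequences. -/
theorem exists_ultrapower (Y : Type) [NormedAddCommGroup Y] [NormedSpace ℝ Y] [CompleteSpace Y] :
    ∃ (X : Type) (_ : NormedAddCommGroup X) (_ : NormedSpace ℝ X) (_ : CompleteSpace X)
      (Q : (ℕ →ᵇ Y) →ₗ[ℝ] X), Function.Surjective Q ∧
      ∀ u : ℕ →ᵇ Y, Tendsto (fun n => ‖u n‖) (hyperfilter ℕ) (𝓝 ‖Q u‖) := by
  classical
  set U : Filter ℕ := (hyperfilter ℕ : Filter ℕ) with hU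
  set M : Submodule ℝ (ℕ →ᵇ Y) :=
    { carrier := {u | Tendsto u U (𝓝 0)}
      add_mem' := fun {u v} hu hv => by
        have := Tendsto.add hu hv
        rw [add_zero] at this
        exact this
      zero_mem' := tendsto_const_nhds
      smul_mem' := fun a u hu => by simpa using Tendsto.const_smul hu a } with hM
  have hMmem : ∀ u, u ∈ M ↔ Tendsto u U (𝓝 0) := fun u => Iff.rfl
  have hcl : IsClosed (M : Set (ℕ →ᵇ Y)) := by
    refine isClosed_of_closure_subset fun u hu => ?_
    change Tendsto u U (𝓝 0)
    rw [Metric.tendsto_nhds]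
    intro δ hδ
    obtain ⟨v, hv, huv⟩ := Metric.mem_closure_iff.1 hu (δ / 2) (half_pos hδ)
    filter_upwards [Metric.tendsto_nhds.1 ((hMmem v).1 hv) (δ / 2) (half_pos hδ)] with n hn
    have h1 := (BoundedContinuousFunction.dist_coe_le_dist (f := u) (g := v) n)
    linarith [dist_triangle (u n) (v n) 0]
  have hbd : ∀ u : ℕ →ᵇ Y, Tendsto (fun n => ‖u n‖) U (𝓝 (ulim fun n => ‖u n‖)) := fun u =>
    tendsto_ulim (b := ‖u‖) fun n => by rw [abs_norm]; exact u.norm_coe_le_norm n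
  refine ⟨(ℕ →ᵇ Y) ⧸ M, inferInstance, inferInstance, inferInstance, M.mkQ,
    M.mkQ_surjective, fun u => ?_⟩
  suffices h : ‖M.mkQ u‖ = ulim fun n => ‖u n‖ by rw [h]; exact hbd u
  apply le_antisymm
  · refine le_of_forall_pos_le_add fun δ hδ => ?_
    set l := ulim fun n => ‖u n‖ with hl
    have hl0 : 0 ≤ l := ge_of_tendsto' (hbd u) fun n => norm_nonneg _
    set v : ℕ →ᵇ Y := BoundedContinuousFunction.ofNormedAddCommGroup
      (fun n => if ‖u n‖ ≤ l + δ then u n else 0) continuous_of_discreteTopology (l + δ)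
      (fun n => by split_ifs with h <;> simp [h]; positivity) with hv
    have huv : M.mkQ u = M.mkQ v := by
      rw [← sub_eq_zero, ← map_sub, Submodule.mkQ_apply, Submodule.Quotient.mk_eq_zero, hMmem]
      refine tendsto_const_nhds.congr' ?_
      filter_upwards [(hbd u).eventually (gt_mem_nhds (lt_add_of_pos_right l hδ))] with n hn
      simp [hv, hn.le]
    rw [huv]
    refine (Submodule.Quotient.norm_mk_le M v).trans ?_
    exact BoundedContinuousFunction.norm_ofNormedAddCommGroup_le _ (by positivity) _
  · refine le_of_forall_pos_le_add fun δ hδ => ?_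
    obtain ⟨v, hv, hvn⟩ := Submodule.Quotient.norm_mk_lt (S := M) (M.mkQ u) hδ
    have hmem : v - u ∈ M := (Submodule.Quotient.eq M).1 hv
    refine le_trans ?_ hvn.le
    have h1 : Tendsto (fun n => ‖u n‖ - ‖(v - u) n‖) U (𝓝 ((ulim fun n => ‖u n‖) - ‖(0 : Y)‖)) :=
      (hbd u).sub ((hMmem _).1 hmem).norm
    rw [norm_zero, sub_zero] at h1
    refine le_of_tendsto' h1 fun n => ?_
    have h2 := norm_sub_le (v n) ((v - u) n)
    simp only [BoundedContinuousFunction.coe_sub, Pi.sub_apply, sub_sub_cancel] at h2 ⊢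
    linarith [v.norm_coe_le_norm n]

end Ultrapower

section JConvexity

open Filter Topology BoundedContinuousFunction Finset

/-- The sign pattern `+1, …, +1, -1, …, -1` whose last `+1` is at position `k`. -/
def jsign (k i : ℕ) : ℝ := if i ≤ k then 1 else -1

theorem abs_jsign (k i : ℕ) : |jsign k i| = 1 := by unfold jsign; split_ifs <;> simp

/-- The evaluations at the terms of a bounded sequence converge, along an ultrafilter, to a
functional on the dual space. -/
theorem exists_bidual_limit {E : Type*} [NormedAddCommGroup E] [NormedSpace ℝ E] (x : ℕ → E)
    (hx : ∀ j, ‖x j‖ ≤ 1) :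
    ∃ Φ : StrongDual ℝ (StrongDual ℝ E), ∀ f : StrongDual ℝ E,
      Tendsto (fun j => f (x j)) (hyperfilter ℕ) (𝓝 (Φ f)) := by
  have hb : ∀ (f : StrongDual ℝ E) j, |f (x j)| ≤ ‖f‖ := fun f j => f.unit_le_opNorm _ (hx j)
  have ht := fun f : StrongDual ℝ E => tendsto_ulim (hb f)
  refine ⟨LinearMap.mkContinuous
    { toFun := fun f => ulim fun j => f (x j)
      map_add' := fun f g => ((ht f).add (ht g)).ulim_eq
      map_smul' := fun a f => ((ht f).const_mul a).ulim_eq } 1 fun f => ?_, ht⟩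
  rw [one_mul]
  exact le_of_tendsto' (ht f).abs (hb f)

/-- In a reflexive space every bounded sequence has a point lying in the closed convex hulls of all
its tails. -/
theorem IsReflexiveBanach.exists_mem_closure_convexHull_tails {X : Type} [NormedAddCommGroup X]
    [NormedSpace ℝ X] (hX : IsReflexiveBanach X) (x : ℕ → X) (hx : ∀ j, ‖x j‖ ≤ 1) :
    ∃ y, ∀ m, y ∈ closure (convexHull ℝ (x '' {j | m ≤ j})) := by
  obtain ⟨Φ, hΦ⟩ := exists_bidual_limit x hx
  obtain ⟨y, rfl⟩ := hX Φ
  refine ⟨y, fun m => ?_⟩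
  by_contra hy
  obtain ⟨f, u, hu, huy⟩ := geometric_hahn_banach_closed_point
    (convex_convexHull ℝ (x '' {j | m ≤ j})).closure isClosed_closure hy
  have h := hΦ f
  rw [NormedSpace.dual_def] at h
  have : f y ≤ u := le_of_tendsto h (eventually_hyperfilter_of_ge m fun j hj =>
    (hu _ (subset_closure (subset_convexHull ℝ _ ⟨j, hj, rfl⟩))).le)
  linarith

/-- If a sign pattern almost attains the triangle inequality on vectors of the unit ball, then a
single functional almost norms all of these vectors simultaneously. -/
theorem exists_dual_of_lt_norm_sum {Y : Type*} [NormedAddCommGroup Y] [NormedSpace ℝ Y]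
    {n k : ℕ} {x : ℕ → Y} (hx : ∀ i, ‖x i‖ ≤ 1)
    (h : (n : ℝ) - 1 / 2 < ‖∑ i ∈ range n, jsign k i • x i‖) :
    ∃ f : StrongDual ℝ Y, ‖f‖ ≤ 1 ∧ ∀ i < n, 1 / 2 ≤ jsign k i * f (x i) := by
  obtain ⟨f, hf1, hf⟩ := exists_dual_vector'' ℝ (∑ i ∈ range n, jsign k i • x i)
  refine ⟨f, hf1, fun i hi => ?_⟩
  have hle : ∀ j, jsign k j * f (x j) ≤ 1 := fun j => by
    have h1 : |f (x j)| ≤ 1 := (f.unit_le_opNorm _ (hx j)).trans hf1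
    refine (le_abs_self _).trans ?_
    rw [abs_mul, abs_jsign, one_mul]
    exact h1
  rw [map_sum] at hf
  simp only [map_smul, smul_eq_mul] at hf
  rw [← Finset.sum_erase_add _ _ (mem_range.2 hi)] at hf
  have h2 : ∑ j ∈ (range n).erase i, jsign k j * f (x j) ≤ (n - 1 : ℝ) := by
    refine (Finset.sum_le_card_nsmul _ _ 1 fun j _ => hle j).trans ?_
    rw [card_erase_of_mem (mem_range.2 hi), card_range, nsmul_eq_mul, mul_one,
      Nat.cast_sub (by omega), Nat.cast_one]
  have h3 : ((‖∑ i ∈ range n, jsign k i • x i‖ : ℝ) : ℝ) =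
      ∑ j ∈ (range n).erase i, jsign k j * f (x j) + jsign k i * f (x i) := by
    rw [hf]; rfl
  linarith

/-- Superreflexive spaces are `J`-convex. -/
theorem SuperReflexive.exists_jconvex {Y : Type} [NormedAddCommGroup Y] [NormedSpace ℝ Y]
    [CompleteSpace Y] (hY : SuperReflexive Y) :
    ∃ n : ℕ, 1 ≤ n ∧ ∀ x : ℕ → Y, (∀ i, ‖x i‖ ≤ 1) →
      ∃ k < n, ‖∑ i ∈ range n, jsign k i • x i‖ ≤ n - 1 / 2 := by
  by_contra! hno
  choose x hx hxk using fun r : ℕ => hno (r + 1) (by omega)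
  have hf : ∀ r k : ℕ, ∃ f : StrongDual ℝ Y, ‖f‖ ≤ 1 ∧
      (k ≤ r → ∀ i ≤ r, 1 / 2 ≤ jsign k i * f (x r i)) := by
    intro r k
    by_cases hk : k ≤ r
    · obtain ⟨f, h1, h2⟩ := exists_dual_of_lt_norm_sum (hx r) (hxk r k (by omega))
      exact ⟨f, h1, fun _ i hi => h2 i (by omega)⟩
    · exact ⟨0, by simp, fun h => absurd h hk⟩
  choose f hf1 hf using hf
  obtain ⟨X, _, _, _, Q, hQ, hlim⟩ := exists_ultrapower Y
  have hX := hY X (finitelyRepresentable_of_quotient Q hQ hlim)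
  set u : ℕ → (ℕ →ᵇ Y) := fun j => BoundedContinuousFunction.ofNormedAddCommGroup
    (fun r => x r j) continuous_of_discreteTopology 1 (fun r => hx r j) with hu
  have hur : ∀ j r, u j r = x r j := fun j r => rfl
  have hu1 : ∀ j, ‖Q (u j)‖ ≤ 1 := fun j => le_of_tendsto' (hlim (u j)) fun r => hx r j
  obtain ⟨y, hy⟩ := hX.exists_mem_closure_convexHull_tails (fun j => Q (u j)) hu1
  have hsep : ∀ k, ∀ a ∈ convexHull ℝ ((fun j => Q (u j)) '' {j | j ≤ k}),
      ∀ b ∈ convexHull ℝ ((fun j => Q (u j)) '' {j | k + 1 ≤ j}), 1 ≤ ‖a - b‖ := by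
    intro k a ha b hb
    have himg : ∀ s : Set ℕ, (fun j => Q (u j)) '' s = Q '' (u '' s) := fun s => by
      rw [Set.image_image]
    rw [himg, ← LinearMap.image_convexHull] at ha hb
    obtain ⟨a, ha, rfl⟩ := ha
    obtain ⟨b, hb, rfl⟩ := hb
    have hconv : ∀ σ : ℝ, Convex ℝ {w : ℕ →ᵇ Y |
        ∀ᶠ r in (hyperfilter ℕ : Filter ℕ), 1 / 2 ≤ σ * f r k (w r)} := by
      intro σ w hw w' hw' α β hα hβ hαβ
      filter_upwards [hw, hw'] with r h h'
      simp only [BoundedContinuousFunction.coe_add, BoundedContinuousFunction.coe_smul,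
        Pi.add_apply, map_add, map_smul, smul_eq_mul]
      nlinarith [mul_le_mul_of_nonneg_left h hα, mul_le_mul_of_nonneg_left h' hβ]
    have ha' := convexHull_min (s := u '' {j | j ≤ k}) (by
      rintro _ ⟨j, hj, rfl⟩
      refine eventually_hyperfilter_of_ge (max j k) fun r hr => ?_
      have := hf r k (by omega) j (by omega)
      rwa [jsign, if_pos (show j ≤ k from hj)] at this) (hconv 1) ha
    have hb' := convexHull_min (s := u '' {j | k + 1 ≤ j}) (by
      rintro _ ⟨j, hj, rfl⟩
      refine eventually_hyperfilter_of_ge (max j k) fun r hr => ?_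
      have := hf r k (by omega) j (by omega)
      rwa [jsign, if_neg (not_le.2 (show k + 1 ≤ j from hj))] at this) (hconv (-1)) hb
    rw [← map_sub]
    refine ge_of_tendsto (hlim (a - b)) ?_
    filter_upwards [ha', hb'] with r h h'
    have h1 := (f r k).le_of_opNorm_le (hf1 r k) ((a - b) r)
    rw [one_mul, Real.norm_eq_abs] at h1
    refine le_trans ?_ h1
    refine le_trans ?_ (le_abs_self _)
    simp only [BoundedContinuousFunction.coe_sub, Pi.sub_apply, map_sub]
    linarith
  obtain ⟨a, ha, hya⟩ := Metric.mem_closure_iff.1 (hy 0) (1 / 4) (by norm_num)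
  obtain ⟨k, hk⟩ : ∃ k, a ∈ convexHull ℝ ((fun j => Q (u j)) '' {j | j ≤ k}) := by
    have hdir : Convex ℝ (⋃ k : ℕ, convexHull ℝ ((fun j => Q (u j)) '' {j | j ≤ k})) := by
      refine Directed.convex_iUnion (Monotone.directed_le fun k l hkl => ?_)
        fun k => convex_convexHull ℝ _
      exact convexHull_mono (Set.image_mono fun j hj => le_trans hj hkl)
    refine Set.mem_iUnion.1 (convexHull_min ?_ hdir ha)
    rintro _ ⟨j, -, rfl⟩
    exact Set.mem_iUnion.2 ⟨j, subset_convexHull ℝ _ ⟨j, by simp, rfl⟩⟩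
  obtain ⟨b, hb, hyb⟩ := Metric.mem_closure_iff.1 (hy (k + 1)) (1 / 4) (by norm_num)
  have h1 := hsep k a hk b hb
  rw [← dist_eq_norm] at h1
  linarith [dist_triangle_left a b y]

end JConvexity

section QuadraticInequality

open Finset

/-- The quadratic form of `J`-convexity, for a seminorm. -/
def JIneq {E : Type*} [AddCommGroup E] [Module ℝ E] (γ : ℝ) (n : ℕ) (p : E → ℝ) : Prop :=
  ∀ x : ℕ → E, ∑ k ∈ range n, p (∑ i ∈ range n, jsign k i • x i) ^ 2 ≤
    γ * ∑ i ∈ range n, p (x i) ^ 2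

theorem sq_le_of_le_sum_sub_min {n : ℕ} (hn : 1 ≤ n) {a : ℕ → ℝ} {i₀ : ℕ} (hi₀ : i₀ < n)
    (ha : ∀ i < n, a i₀ ≤ a i) (ha0 : 0 ≤ a i₀) {b : ℝ} (hb0 : 0 ≤ b)
    (hb : b ≤ ∑ i ∈ range n, a i - a i₀ / 2) :
    b ^ 2 ≤ (n - 1 / (2 * n)) * ∑ i ∈ range n, a i ^ 2 := by
  have hn0 : (0 : ℝ) < n := by exact_mod_cast hn
  set α := a i₀ with hα
  set d : ℕ → ℝ := fun i => a i - α with hd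
  set D := ∑ i ∈ range n, d i with hD
  set V := ∑ i ∈ range n, d i ^ 2 with hV
  set m := ∑ i ∈ range n, a i with hm
  set S := ∑ i ∈ range n, a i ^ 2 with hS
  have hd0 : ∀ i ∈ range n, 0 ≤ d i := fun i hi => sub_nonneg.2 (ha i (mem_range.1 hi))
  have hmD : m = D + n * α := by
    simp [hD, hd, hm]
  have hSD : S = V + 2 * α * D + n * α ^ 2 := by
    have : ∀ i, a i ^ 2 = d i ^ 2 + 2 * α * d i + α ^ 2 := fun i => by simp only [hd]; ring
    simp only [hS, this, sum_add_distrib, ← mul_sum, hV, hD]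
    simp
  have hDV : D ^ 2 ≤ (n - 1) * V := by
    have h1 : D = ∑ i ∈ (range n).erase i₀, d i := by
      rw [hD, ← Finset.sum_erase_add _ _ (mem_range.2 hi₀)]; simp [hd, hα]
    have h2 : V = ∑ i ∈ (range n).erase i₀, d i ^ 2 := by
      rw [hV, ← Finset.sum_erase_add _ _ (mem_range.2 hi₀)]; simp [hd, hα]
    rw [h1, h2]
    refine sq_sum_le_card_mul_sum_sq.trans (le_of_eq ?_)
    rw [card_erase_of_mem (mem_range.2 hi₀), card_range, Nat.cast_sub hn, Nat.cast_one]
  have hD0 : 0 ≤ D := sum_nonneg hd0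
  have hV0 : 0 ≤ V := sum_nonneg fun i _ => sq_nonneg _
  have hSm : S ≤ m ^ 2 := by
    have ha' : ∀ i ∈ range n, 0 ≤ a i := fun i hi => ha0.trans (ha i (mem_range.1 hi))
    rw [hS, hm, sq (∑ i ∈ range n, a i), sum_mul]
    exact sum_le_sum fun i hi => by
      rw [sq]
      exact mul_le_mul_of_nonneg_left (single_le_sum ha' hi) (ha' i hi)
  have hbm : b ^ 2 ≤ (m - α / 2) ^ 2 := pow_le_pow_left₀ hb0 hb 2
  have hn1 : (1 : ℝ) ≤ n := by exact_mod_cast hn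
  have key : m ^ 2 / 2 ≤ n * (n * S - b ^ 2) := by
    have e1 : n * S - m ^ 2 = n * V - D ^ 2 := by rw [hmD, hSD]; ring
    have e2 : D ^ 2 ≤ n * V := by nlinarith
    have e3 : D ^ 2 ≤ n * (n * V - D ^ 2) := by nlinarith
    have e4 : n * (m ^ 2 - b ^ 2) ≥ 3 / 4 * (n * α) * m := by
      have : α ≤ m := by nlinarith
      nlinarith [mul_nonneg ha0 (sub_nonneg.2 this), mul_le_mul_of_nonneg_left hbm hn0.le]
    nlinarith [sq_nonneg (D - 3 / 5 * (n * α)), mul_nonneg hD0 (mul_nonneg hn0.le ha0),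
      mul_nonneg hn0.le ha0]
  have h3 : S / 2 ≤ n * (n * S - b ^ 2) := by linarith
  have h4 : S / 2 / n ≤ n * S - b ^ 2 := by rwa [div_le_iff₀' hn0]
  have h5 : (n - 1 / (2 * n)) * S = n * S - S / 2 / n := by field_simp
  linarith

/-- `J`-convexity implies its quadratic form. -/
theorem exists_jIneq_of_jconvex {Y : Type*} [NormedAddCommGroup Y] [NormedSpace ℝ Y] {n : ℕ}
    (hn : 1 ≤ n) (h : ∀ x : ℕ → Y, (∀ i, ‖x i‖ ≤ 1) →
      ∃ k < n, ‖∑ i ∈ range n, jsign k i • x i‖ ≤ n - 1 / 2) :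
    ∃ γ : ℝ, 0 ≤ γ ∧ γ < n ^ 2 ∧ JIneq γ n (fun y : Y => ‖y‖) := by
  have hn0 : (0 : ℝ) < n := by exact_mod_cast hn
  have hn1 : (1 : ℝ) ≤ n := by exact_mod_cast hn
  refine ⟨n ^ 2 - 1 / (2 * n), ?_, sub_lt_self _ (by positivity), fun x => ?_⟩
  · rw [sub_nonneg, div_le_iff₀ (by positivity)]
    nlinarith [pow_le_pow_left₀ zero_le_one hn1 3]
  obtain ⟨i₀, hi₀, hmin⟩ := exists_min_image (range n) (fun i => ‖x i‖) ⟨0, mem_range.2 hn⟩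
  obtain ⟨k, hk, hkx⟩ := h (fun i => (‖x i‖⁻¹ : ℝ) • x i) fun i => by
    rw [norm_smul, norm_inv, norm_norm]; exact inv_mul_le_one
  set m := ∑ i ∈ range n, ‖x i‖ with hm
  set S := ∑ i ∈ range n, ‖x i‖ ^ 2 with hS
  have hle : ∀ l, ‖∑ i ∈ range n, jsign l i • x i‖ ≤ m := fun l =>
    norm_sum_le_of_le _ fun i _ => by rw [norm_smul, Real.norm_eq_abs, abs_jsign, one_mul]
  have hsq : ∀ l, ‖∑ i ∈ range n, jsign l i • x i‖ ^ 2 ≤ n * S := fun l => by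
    refine (pow_le_pow_left₀ (norm_nonneg _) (hle l) 2).trans ?_
    simpa using sq_sum_le_card_mul_sum_sq (s := range n) (f := fun i => ‖x i‖)
  have hgood : ‖∑ i ∈ range n, jsign k i • x i‖ ≤ m - ‖x i₀‖ / 2 := by
    have e : ∑ i ∈ range n, jsign k i • x i =
        ∑ i ∈ range n, (jsign k i * (‖x i‖ - ‖x i₀‖)) • (‖x i‖⁻¹ : ℝ) • x i +
          ‖x i₀‖ • ∑ i ∈ range n, jsign k i • (‖x i‖⁻¹ : ℝ) • x i := by
      rw [smul_sum, ← sum_add_distrib]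
      refine sum_congr rfl fun i _ => ?_
      rcases eq_or_ne (x i) 0 with h0 | h0
      · simp [h0]
      · have : ‖x i‖ ≠ 0 := norm_ne_zero_iff.2 h0
        rw [smul_comm ‖x i₀‖, smul_smul, smul_smul, smul_smul, ← add_smul]
        congr 1
        field_simp
        ring
    rw [e]
    refine (norm_add_le _ _).trans ?_
    have h1 : ‖∑ i ∈ range n, (jsign k i * (‖x i‖ - ‖x i₀‖)) • (‖x i‖⁻¹ : ℝ) • x i‖ ≤
        ∑ i ∈ range n, (‖x i‖ - ‖x i₀‖) := by
      refine norm_sum_le_of_le _ fun i hi => ?_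
      have hd := sub_nonneg.2 (hmin i hi)
      rw [norm_smul, norm_smul, Real.norm_eq_abs, abs_mul, abs_jsign, one_mul, abs_of_nonneg hd,
        norm_inv, norm_norm]
      exact mul_le_of_le_one_right hd inv_mul_le_one
    rw [sum_sub_distrib, sum_const, card_range, nsmul_eq_mul] at h1
    rw [norm_smul, norm_norm]
    have h2 := mul_le_mul_of_nonneg_left hkx (norm_nonneg (x i₀))
    linarith
  have hfin := sq_le_of_le_sum_sub_min hn (mem_range.1 hi₀)
    (a := fun i => ‖x i‖)
    (fun i hi => hmin i (mem_range.2 hi)) (norm_nonneg _) (norm_nonneg _) hgood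
  rw [← Finset.sum_erase_add _ _ (mem_range.2 hk)]
  have hrest : ∑ l ∈ (range n).erase k, ‖∑ i ∈ range n, jsign l i • x i‖ ^ 2 ≤
      (n - 1) * (n * S) := by
    refine (Finset.sum_le_card_nsmul _ _ _ fun l _ => hsq l).trans ?_
    rw [card_erase_of_mem (mem_range.2 hk), card_range, nsmul_eq_mul, Nat.cast_sub hn,
      Nat.cast_one]
  calc _ ≤ (n - 1) * (n * S) + (n - 1 / (2 * n)) * S := add_le_add hrest hfin
    _ = _ := by ring

end QuadraticInequality

section Spreading

open Filter Topology Finset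

/-- The iterated limit of `p (v + ∑ i < n, c i • z (j i))` as `j 0 > j 1 > … > j (n - 1)` tend to
infinity, the later indices first. -/
def spread {E : Type*} [AddCommGroup E] [Module ℝ E] (p : E → ℝ) (z : ℕ → E) (c : ℕ → ℝ) :
    ℕ → E → ℝ
  | 0, v => p v
  | n + 1, v => ulim fun j => spread p z c n (v + c n • z j)

variable {E : Type*} [AddCommGroup E] [Module ℝ E] {p : Seminorm ℝ E} {z : ℕ → E}

theorem spread_bounds (hz : ∀ j, p (z j) ≤ 1) (c : ℕ → ℝ) (n : ℕ) (v : E) :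
    0 ≤ spread p z c n v ∧ spread p z c n v ≤ p v + ∑ i ∈ range n, |c i| := by
  induction n generalizing v with
  | zero => simp [spread]
  | succ n ih =>
    have hup : ∀ j, spread p z c n (v + c n • z j) ≤ p v + ∑ i ∈ range (n + 1), |c i| := by
      intro j
      refine (ih _).2.trans ?_
      have h1 := map_add_le_add p v (c n • z j)
      rw [map_smul_eq_mul, Real.norm_eq_abs] at h1
      have h2 := mul_le_mul_of_nonneg_left (hz j) (abs_nonneg (c n))
      rw [sum_range_succ]
      linarith
    have ht : Tendsto (fun j => spread p z c n (v + c n • z j)) (hyperfilter ℕ) (𝓝 _) :=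
      tendsto_ulim fun j => by rw [abs_of_nonneg (ih _).1]; exact hup j
    exact ⟨ge_of_tendsto' ht fun j => (ih _).1, le_of_tendsto' ht hup⟩

theorem tendsto_spread (hz : ∀ j, p (z j) ≤ 1) (c : ℕ → ℝ) (n : ℕ) (v : E) :
    Tendsto (fun j => spread p z c n (v + c n • z j)) (hyperfilter ℕ)
      (𝓝 (spread p z c (n + 1) v)) := by
  refine tendsto_ulim (b := p v + |c n| + ∑ i ∈ range n, |c i|) fun j => ?_
  obtain ⟨h0, h1⟩ := spread_bounds hz c n (v + c n • z j)
  rw [abs_of_nonneg h0]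
  have h2 := map_add_le_add p v (c n • z j)
  rw [map_smul_eq_mul, Real.norm_eq_abs] at h2
  have h3 := mul_le_mul_of_nonneg_left (hz j) (abs_nonneg (c n))
  linarith

theorem spread_smul (hz : ∀ j, p (z j) ≤ 1) (a : ℝ) (c : ℕ → ℝ) (n : ℕ) (v : E) :
    spread p z (a • c) n (a • v) = |a| * spread p z c n v := by
  induction n generalizing v with
  | zero => simp [spread, map_smul_eq_mul]
  | succ n ih =>
    refine Filter.Tendsto.ulim_eq ?_
    refine ((tendsto_spread hz c n v).const_mul |a|).congr fun j => ?_
    rw [← ih, Pi.smul_apply, smul_add, smul_assoc]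

theorem spread_jIneq (hz : ∀ j, p (z j) ≤ 1) {γ : ℝ} {m : ℕ} (hp : JIneq γ m p)
    (c : ℕ → ℕ → ℝ) (n : ℕ) (v : ℕ → E) :
    ∑ k ∈ range m, spread p z (∑ i ∈ range m, jsign k i • c i) n
        (∑ i ∈ range m, jsign k i • v i) ^ 2 ≤
      γ * ∑ i ∈ range m, spread p z (c i) n (v i) ^ 2 := by
  induction n generalizing v with
  | zero => exact hp v
  | succ n ih =>
    refine le_of_tendsto_of_tendsto'
      (tendsto_finsetSum _ fun k _ => (tendsto_spread hz _ n _).pow 2)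
      ((tendsto_finsetSum _ fun i _ => (tendsto_spread hz _ n _).pow 2).const_mul γ)
      fun j => ?_
    refine le_trans (le_of_eq ?_) (ih fun i => v i + c i n • z j)
    refine sum_congr rfl fun k _ => ?_
    congr 2
    simp only [smul_add, sum_add_distrib, Finset.sum_apply, Pi.smul_apply, sum_smul, smul_assoc]

theorem spread_eq_of_eq_zero {c : ℕ → ℝ} {a b : ℕ} (hab : a ≤ b)
    (h : ∀ i, a ≤ i → i < b → c i = 0) (v : E) : spread p z c b v = spread p z c a v := by
  induction b, hab using Nat.le_induction with
  | base => rfl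
  | succ b hb ih =>
    rw [← ih fun i h1 h2 => h i h1 (by omega)]
    simp only [spread, h b hb b.lt_succ_self, zero_smul, add_zero]
    exact Filter.Tendsto.ulim_eq tendsto_const_nhds

theorem spread_extend {φ : ℕ → ℕ} (hφ : StrictMono φ) (c : ℕ → ℝ) (n : ℕ) (v : E) :
    spread p z (Function.extend φ c 0) (φ n) v = spread p z c n v := by
  induction n generalizing v with
  | zero =>
    rw [spread_eq_of_eq_zero (Nat.zero_le _) fun i _ hi => ?_]
    · rfl
    · refine Function.extend_apply' _ _ _ ?_
      rintro ⟨q, rfl⟩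
      exact absurd (hφ.lt_iff_lt.1 hi) (Nat.not_lt_zero q)
  | succ n ih =>
    rw [spread_eq_of_eq_zero (a := φ n + 1) (hφ n.lt_succ_self) fun i h1 h2 => ?_]
    · simp only [spread, hφ.injective.extend_apply, ih]
    · refine Function.extend_apply' _ _ _ ?_
      rintro ⟨q, rfl⟩
      have := hφ.lt_iff_lt.1 (Nat.lt_of_succ_le h1)
      have := hφ.lt_iff_lt.1 h2
      omega

/-- Lower estimate of spreads by the prefix sums of the coefficients. -/
theorem le_spread {p : Seminorm ℝ (ℕ →₀ ℝ)} {z : ℕ → ℕ →₀ ℝ} (hz : ∀ j, p (z j) ≤ 1) {θ : ℝ}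
    (hθ : ∀ v k, θ * |v k| ≤ p v) (hzk : ∀ j k, k ≤ j → z j k = 1)
    (c : ℕ → ℝ) {m n : ℕ} (hmn : m ≤ n) (v : ℕ →₀ ℝ) :
    θ * |∑ i ∈ range m, c i| ≤ spread p z c n v := by
  have hfix : ∀ n k, ∀ v : ℕ →₀ ℝ, θ * |v k + ∑ i ∈ range n, c i| ≤ spread p z c n v := by
    intro n k
    induction n with
    | zero => intro v; simpa [spread] using hθ v k
    | succ n ih =>
      intro v
      refine ge_of_tendsto (tendsto_spread hz c n v) (eventually_hyperfilter_of_ge k fun j hj => ?_)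
      refine le_trans (le_of_eq ?_) (ih _)
      simp only [Finsupp.add_apply, Finsupp.smul_apply, hzk j k hj, sum_range_succ, smul_eq_mul]
      congr 2
      ring
  induction n, hmn using Nat.le_induction generalizing v with
  | base =>
    obtain ⟨k, hk⟩ := Infinite.exists_notMem_finset v.support
    have := hfix m k v
    rwa [Finsupp.notMem_support_iff.1 hk, zero_add] at this
  | succ n hn ih => exact ge_of_tendsto' (tendsto_spread hz c n v) fun j => ih _

end Spreading

section Oscillation

open Filter Topology Finset

/-- The prefix sums of `c`, which vanishes from `N` on, take the values `1, -1, 1, …` (`M` terms)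
at the positions `t 0 < t 1 < …`. -/
def Oscillates (M N : ℕ) (c : ℕ → ℝ) (t : ℕ → ℕ) : Prop :=
  (∀ i, N ≤ i → c i = 0) ∧ StrictMono t ∧ ∀ l < M, ∑ i ∈ range (t l), c i = (-1) ^ l

theorem exists_oscillates (M : ℕ) :
    ∃ c, Oscillates M M c (fun l => l + 1) ∧ ∀ i, |c i| ≤ 2 := by
  set c : ℕ → ℝ := fun i => if i < M then (if i = 0 then 1 else 2 * (-1) ^ i) else 0 with hc
  refine ⟨c, ⟨fun i hi => by simp [hc, hi], fun a b h => by simpa using h, fun l hl => ?_⟩,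
    fun i => ?_⟩
  · induction l with
    | zero => simp [hc, hl]
    | succ l ih =>
      rw [sum_range_succ, ih (by omega)]
      simp only [hc, hl, if_true, Nat.succ_ne_zero, if_false]
      rw [pow_succ]; ring
  · simp only [hc]
    split_ifs <;> simp [abs_mul]

theorem sum_range_extend {φ : ℕ → ℕ} (hφ : Function.Injective φ) {c : ℕ → ℝ} {N : ℕ}
    (hc : ∀ i, N ≤ i → c i = 0) {τ s : ℕ} (h : ∀ q < N, φ q < τ ↔ q < s) :
    ∑ j ∈ range τ, Function.extend φ c 0 j = ∑ q ∈ range s, c q := by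
  have h1 : ∑ q ∈ range s, c q = ∑ q ∈ (range s).filter (· < N), c q := by
    rw [sum_filter_of_ne]
    intro q _ hq
    by_contra hN
    exact hq (hc q (not_lt.1 hN))
  have h2 : ∑ q ∈ (range s).filter (· < N), c q =
      ∑ j ∈ ((range s).filter (· < N)).image φ, Function.extend φ c 0 j := by
    rw [sum_image hφ.injOn]
    exact sum_congr rfl fun q _ => (hφ.extend_apply c 0 q).symm
  rw [h1, h2]
  symm
  refine sum_subset ?_ ?_
  · intro j hj
    obtain ⟨q, hq, rfl⟩ := mem_image.1 hj
    rw [mem_filter, mem_range] at hq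
    exact mem_range.2 ((h q hq.2).2 hq.1)
  · intro j hj hj'
    by_cases hex : ∃ q, φ q = j
    · obtain ⟨q, rfl⟩ := hex
      rw [hφ.extend_apply]
      by_contra hne
      have hqN : q < N := by
        by_contra hN
        exact hne (hc q (not_lt.1 hN))
      refine hj' (mem_image_of_mem _ ?_)
      rw [mem_filter, mem_range]
      exact ⟨(h q hqN).1 (mem_range.1 hj), hqN⟩
    · exact Function.extend_apply' _ _ _ hex

/-- An oscillating sequence can be spread out in `n` interlaced ways such that every signed average
of the copies oscillates one time less. -/
theorem Oscillates.exists_interlaced {M N : ℕ} {c : ℕ → ℝ} {t : ℕ → ℕ}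
    (h : Oscillates (M + 1) N c t) {n : ℕ} (hn : 1 ≤ n) :
    ∃ (φ : ℕ → ℕ → ℕ) (N' : ℕ), (∀ i, StrictMono (φ i)) ∧ (∀ i < n, φ i N ≤ N') ∧
      ∀ k < n, ∃ s, Oscillates M N'
        ((-(1 / n) : ℝ) • ∑ i ∈ range n, jsign k i • Function.extend (φ i) c 0) s := by
  obtain ⟨hc, ht, hsum⟩ := h
  have hex : ∀ q, ∃ l, q < t l := fun q => ⟨q + 1, Nat.lt_of_succ_le (ht.le_apply)⟩
  set b : ℕ → ℕ := fun q => Nat.find (hex q) with hb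
  have hble : ∀ q l, b q ≤ l ↔ q < t l := by
    intro q l
    rw [hb, Nat.find_le_iff]
    exact ⟨fun ⟨m, hm, hq⟩ => hq.trans_le (ht.monotone hm), fun hq => ⟨l, le_rfl, hq⟩⟩
  have hbmono : Monotone b := fun q q' hq => (hble q _).2 (hq.trans_lt ((hble q' _).1 le_rfl))
  set L := N + 1 with hL
  set φ : ℕ → ℕ → ℕ := fun i q => L * (n * b q + i) + q with hφ
  have hφmono : ∀ i, StrictMono (φ i) := by
    intro i q q' hq
    have h1 : n * b q + i ≤ n * b q' + i := by
      have := Nat.mul_le_mul_left n (hbmono hq.le); omega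
    have h2 := Nat.mul_le_mul_left L h1
    simp only [hφ]; omega
  have hφi : ∀ i < n, φ i N ≤ φ n N := by
    intro i hi
    have := Nat.mul_le_mul_left L (show n * b N + i ≤ n * b N + n by omega)
    simp only [hφ]; omega
  refine ⟨φ, φ n N, hφmono, hφi, fun k hk => ?_⟩
  have hlt : ∀ i < n, ∀ l, ∀ q < N, φ i q < L * (n * (l + 1) + k + 1) ↔
      q < (if i ≤ k then t (l + 1) else t l) := by
    intro i hi l q hq
    have h1 : φ i q < L * (n * (l + 1) + k + 1) ↔ n * b q + i ≤ n * (l + 1) + k := by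
      simp only [hφ]
      constructor
      · intro h
        by_contra! h'
        have := Nat.mul_le_mul_left L (Nat.succ_le_of_lt h')
        rw [Nat.succ_eq_add_one] at this
        omega
      · intro h
        have := Nat.mul_le_mul_left L h
        rw [mul_add L _ 1, mul_one]
        omega
    rw [h1]
    split_ifs with hik
    · rw [← hble]
      constructor
      · intro h
        by_contra! h'
        have := Nat.mul_le_mul_left n (Nat.succ_le_of_lt h')
        rw [Nat.succ_eq_add_one, mul_add n _ 1, mul_one] at this
        omega
      · intro h
        have := Nat.mul_le_mul_left n h
        omega
    · rw [← hble]
      constructor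
      · intro h
        by_contra! h'
        have := Nat.mul_le_mul_left n (Nat.succ_le_of_lt h')
        rw [Nat.succ_eq_add_one] at this
        omega
      · intro h
        have := Nat.mul_le_mul_left n h
        rw [mul_add n l 1, mul_one]
        omega
  refine ⟨fun l => L * (n * (l + 1) + k + 1), fun j hj => ?_, fun l l' hl => ?_, fun l hl => ?_⟩
  · have hzero : ∀ i ∈ range n, jsign k i • Function.extend (φ i) c 0 j = 0 := by
      intro i hi
      by_cases hex : ∃ q, φ i q = j
      · obtain ⟨q, rfl⟩ := hex
        rw [(hφmono i).injective.extend_apply, hc, smul_zero]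
        exact (hφmono i).le_iff_le.1 ((hφi i (mem_range.1 hi)).trans hj)
      · rw [Function.extend_apply' _ _ _ hex, Pi.zero_apply, smul_zero]
    simp only [Pi.smul_apply, Finset.sum_apply, sum_eq_zero hzero, smul_zero]
  · have h1 : n * (l + 1) < n * (l' + 1) := Nat.mul_lt_mul_of_pos_left (by omega) (by omega)
    exact Nat.mul_lt_mul_of_pos_left (by omega) (by omega)
  · have hterm : ∀ i ∈ range n, ∑ j ∈ range (L * (n * (l + 1) + k + 1)),
        jsign k i * Function.extend (φ i) c 0 j = -(-1) ^ l := by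
      intro i hi
      rw [← mul_sum, sum_range_extend (hφmono i).injective hc (hlt i (mem_range.1 hi) l), jsign]
      split_ifs with hik
      · rw [hsum (l + 1) (by omega), pow_succ]; ring
      · rw [hsum l (by omega)]; ring
    simp only [Pi.smul_apply, Finset.sum_apply, smul_eq_mul]
    rw [← mul_sum, sum_comm, sum_congr rfl hterm, sum_const, card_range, nsmul_eq_mul]
    have : (n : ℝ) ≠ 0 := by positivity
    field_simp

/-- A seminorm satisfying the quadratic inequality is small at one of the differences of every long
bounded sequence: limit version. -/
theorem not_jIneq_of_le_apply {p : Seminorm ℝ (ℕ →₀ ℝ)} {z : ℕ → ℕ →₀ ℝ} {θ γ : ℝ} {n : ℕ}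
    (hz : ∀ j, p (z j) ≤ 1) (hθ0 : 0 < θ) (hθ : ∀ v k, θ * |v k| ≤ p v)
    (hzk : ∀ j k, k ≤ j → z j k = 1) (hn : 1 ≤ n) (hγ0 : 0 ≤ γ) (hγ : γ < n ^ 2) :
    ¬ JIneq γ n p := by
  intro hJ
  set A : ℕ → Set ℝ := fun M => {h | ∃ c N t, Oscillates M N c t ∧ h = spread p z c N 0} with hA
  have hAbdd : ∀ M, BddBelow (A M) := fun M => ⟨0, by
    rintro _ ⟨c, N, t, -, rfl⟩
    exact (spread_bounds hz c N 0).1⟩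
  have hAne : ∀ M, ∃ h ∈ A M, h ≤ 2 * M := fun M => by
    obtain ⟨c, hc, hc2⟩ := exists_oscillates M
    refine ⟨_, ⟨c, M, _, hc, rfl⟩, ?_⟩
    refine (spread_bounds hz c M 0).2.trans ?_
    rw [map_zero, zero_add]
    refine (sum_le_card_nsmul _ _ 2 fun i _ => hc2 i).trans (le_of_eq ?_)
    rw [card_range, nsmul_eq_mul, mul_comm]
  have hAlow : ∀ M, ∀ h ∈ A (M + 1), θ ≤ h := by
    rintro M _ ⟨c, N, t, hc, rfl⟩
    have h1 : ∑ i ∈ range (min (t 0) N), c i = 1 := by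
      rw [← pow_zero (-1 : ℝ), ← hc.2.2 0 (by omega)]
      refine sum_subset (range_mono (min_le_left _ _)) fun i hi hi' => hc.1 i ?_
      rw [mem_range] at hi hi'
      omega
    have h2 := le_spread hz hθ hzk c (min_le_right (t 0) N) 0
    rwa [h1, abs_one, mul_one] at h2
  set K : ℕ → ℝ := fun M => sInf (A M) with hK
  have hKlow : ∀ M, θ ≤ K (M + 1) := fun M => by
    obtain ⟨h, hh, -⟩ := hAne (M + 1)
    exact le_csInf ⟨h, hh⟩ (hAlow M)
  have hKup : ∀ M : ℕ, K M ≤ 2 * M := fun M => by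
    obtain ⟨h, hh, hle⟩ := hAne M
    exact (csInf_le (hAbdd M) hh).trans hle
  obtain ⟨η, hη0, hη⟩ : ∃ η : ℝ, 0 < η ∧ γ * (1 + η) ^ 4 < n ^ 2 := by
    have hcont : Tendsto (fun η : ℝ => γ * (1 + η) ^ 4) (𝓝[>] 0) (𝓝 (γ * (1 + 0) ^ 4)) :=
      (Continuous.tendsto (by fun_prop) 0).mono_left nhdsWithin_le_nhds
    have := hcont.eventually (gt_mem_nhds (show γ * (1 + 0) ^ 4 < n ^ 2 by simpa using hγ))
    obtain ⟨η, h1, h2⟩ := (this.and self_mem_nhdsWithin).exists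
    exact ⟨η, h2, h1⟩
  obtain ⟨M, hM⟩ : ∃ M, K (M + 2) ≤ (1 + η) * K (M + 1) := by
    by_contra! hcon
    have hexp : ∀ M, θ * (1 + η) ^ M ≤ K (M + 1) := by
      intro M
      induction M with
      | zero => simpa using hKlow 0
      | succ M ih =>
        have := hcon M
        rw [pow_succ]
        nlinarith
    have hlim : Tendsto (fun M : ℕ => (M : ℝ) ^ 1 / (1 + η) ^ M) atTop (𝓝 0) :=
      tendsto_pow_const_div_const_pow_of_one_lt 1 (by linarith)
    obtain ⟨M, hM, hM1⟩ := ((hlim.eventually (gt_mem_nhds (show 0 < θ / 4 by positivity))).and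
      (eventually_ge_atTop 1)).exists
    have h1 := (hexp M).trans (hKup (M + 1))
    rw [pow_one, div_lt_iff₀ (by positivity)] at hM
    have h2 : (1 : ℝ) ≤ M := by exact_mod_cast hM1
    push_cast at h1
    nlinarith
  have hK0 : 0 < K (M + 1) := hθ0.trans_le (hKlow M)
  obtain ⟨_, ⟨c, N, t, hc, rfl⟩, hlt⟩ := exists_lt_of_csInf_lt
    (by obtain ⟨h, hh, -⟩ := hAne (M + 2); exact ⟨h, hh⟩)
    (show sInf (A (M + 2)) < (1 + η) ^ 2 * K (M + 1) by
      change K (M + 2) < _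
      nlinarith [mul_pos hη0 hK0])
  obtain ⟨φ, N', hφ, hφN, hosc⟩ := hc.exists_interlaced hn
  have hcopy : ∀ i ∈ range n, spread p z (Function.extend (φ i) c 0) N' 0 = spread p z c N 0 := by
    intro i hi
    rw [← spread_extend (hφ i) c N 0]
    refine spread_eq_of_eq_zero (hφN i (mem_range.1 hi)) (fun j hj _ => ?_) 0
    by_cases hex : ∃ q, φ i q = j
    · obtain ⟨q, rfl⟩ := hex
      rw [(hφ i).injective.extend_apply]
      exact hc.1 q ((hφ i).le_iff_le.1 hj)
    · exact Function.extend_apply' _ _ _ hex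
  have hcomb : ∀ k ∈ range n, n * K (M + 1) ≤
      spread p z (∑ i ∈ range n, jsign k i • Function.extend (φ i) c 0) N' 0 := by
    intro k hk
    obtain ⟨s, hs⟩ := hosc k (mem_range.1 hk)
    have h1 : K (M + 1) ≤ _ := csInf_le (hAbdd _) ⟨_, _, _, hs, rfl⟩
    have h2 := spread_smul hz (-(1 / n) : ℝ)
      (∑ i ∈ range n, jsign k i • Function.extend (φ i) c 0) N' 0
    rw [smul_zero] at h2
    rw [h2, abs_neg, abs_of_nonneg (by positivity), one_div, le_inv_mul_iff₀ (by positivity)] at h1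
    exact h1
  have hfin := spread_jIneq hz hJ (fun i => Function.extend (φ i) c 0) N' 0
  simp only [Pi.zero_apply, smul_zero, sum_const_zero] at hfin
  rw [sum_congr (s₁ := range n) (f := fun i => spread p z (Function.extend (φ i) c 0) N' 0 ^ 2)
    rfl fun i hi => congrArg (· ^ 2) (hcopy i hi), sum_const, card_range, nsmul_eq_mul] at hfin
  have h1 := (card_nsmul_le_sum (range n) _ ((n * K (M + 1)) ^ 2) fun k hk =>
    pow_le_pow_left₀ (by positivity) (hcomb k hk) 2).trans hfin
  rw [card_range, nsmul_eq_mul] at h1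
  have hs0 := (spread_bounds hz c N 0).1
  have h2 := mul_le_mul_of_nonneg_left (pow_le_pow_left₀ hs0 hlt.le 2) hγ0
  have hn0 : (0 : ℝ) < n := by positivity
  have h3 : (n : ℝ) * (n ^ 2 * K (M + 1) ^ 2) ≤ n * (γ * (1 + η) ^ 4 * K (M + 1) ^ 2) := by
    nlinarith
  have h4 := le_of_mul_le_mul_left h3 hn0
  have h5 := le_of_mul_le_mul_right h4 (by positivity)
  linarith

end Oscillation

section SmallCoordinate

open Filter Topology Finset

/-- Restriction of a sequence to the indices below `m`. -/
def truncate (m : ℕ) : (ℕ → ℝ) →ₗ[ℝ] (ℕ → ℝ) where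
  toFun c i := if i < m then c i else 0
  map_add' c d := by ext i; by_cases h : i < m <;> simp [h]
  map_smul' a c := by ext i; by_cases h : i < m <;> simp [h]

theorem truncate_apply (m : ℕ) (c : ℕ → ℝ) (i : ℕ) :
    truncate m c i = if i < m then c i else 0 := rfl

theorem truncate_truncate (m n : ℕ) (c : ℕ → ℝ) :
    truncate m (truncate n c) = truncate (min m n) c := by
  ext i
  simp only [truncate_apply, lt_min_iff]
  split_ifs <;> simp_all

theorem JIneq.comp {E F : Type*} [AddCommGroup E] [Module ℝ E] [AddCommGroup F] [Module ℝ F]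
    {γ : ℝ} {n : ℕ} {p : F → ℝ} (h : JIneq γ n p) (T : E →ₗ[ℝ] F) :
    JIneq γ n (fun x => p (T x)) := by
  intro x
  simpa using h fun i => T (x i)

variable {p : Seminorm ℝ (ℕ → ℝ)}

theorem abs_mul_apply_single_le (htr : ∀ m c, p (truncate m c) ≤ p c) (c : ℕ → ℝ) (k : ℕ) :
    |c k| * p (Pi.single k 1) ≤ 2 * p c := by
  have h1 : c k • (Pi.single k 1 : ℕ → ℝ) = truncate (k + 1) c - truncate k c := by
    ext i
    rcases lt_trichotomy i k with h | rfl | h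
    · simp [truncate_apply, h, h.ne, h.trans k.lt_succ_self]
    · simp [truncate_apply]
    · simp [truncate_apply, h.ne', h.not_gt, (Nat.succ_le_of_lt h).not_gt]
  have h2 := map_smul_eq_mul p (c k) (Pi.single k 1)
  rw [Real.norm_eq_abs] at h2
  rw [← h2, h1, two_mul]
  exact (map_sub_le_add p _ _).trans (add_le_add (htr _ _) (htr _ _))

theorem exists_apply_single_lt {γ : ℝ} {n₀ : ℕ} (hn₀ : 1 ≤ n₀) (hγ0 : 0 ≤ γ) (hγ : γ < n₀ ^ 2)
    {θ : ℝ} (hθ : 0 < θ) :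
    ∃ n, ∀ p : Seminorm ℝ (ℕ → ℝ), JIneq γ n₀ p → (∀ m c, p (truncate m c) ≤ p c) →
      p (truncate n 1) ≤ 1 → ∃ k < n, p (Pi.single k 1) < θ := by
  by_contra! hcon
  choose p hJ htr h1 hk using hcon
  set ι : (ℕ →₀ ℝ) →ₗ[ℝ] (ℕ → ℝ) := Finsupp.lcoeFun with hι
  have hιv : ∀ v : ℕ →₀ ℝ, ι v = v := fun v => rfl
  set q : ℕ → Seminorm ℝ (ℕ →₀ ℝ) := fun r => (p r).comp (truncate r ∘ₗ ι) with hq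
  have hqv : ∀ r v, q r v = p r (truncate r (ι v)) := fun r v => rfl
  have hqs : ∀ r k, q r (Finsupp.single k 1) ≤ 2 := by
    intro r k
    rw [hqv, hιv]
    by_cases hkr : k < r
    · have e : truncate r (Finsupp.single k 1 : ℕ →₀ ℝ) = (Pi.single k 1 : ℕ → ℝ) := by
        ext i
        rw [truncate_apply, Finsupp.single_eq_pi_single]
        rcases eq_or_ne i k with rfl | h
        · simp [hkr]
        · simp [h]
      have := abs_mul_apply_single_le (htr r) (truncate r 1) k
      simp only [truncate_apply, hkr, if_true, Pi.one_apply, abs_one, one_mul] at this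
      rw [e]
      linarith [h1 r]
    · have e : truncate r (Finsupp.single k 1 : ℕ →₀ ℝ) = (0 : ℕ → ℝ) := by
        ext i
        rw [truncate_apply, Finsupp.single_eq_pi_single]
        split_ifs with h
        · have : i ≠ k := by omega
          simp [this]
        · rfl
      rw [e, map_zero]
      norm_num
  have hqb : ∀ v, ∃ b, ∀ r, |q r v| ≤ b := by
    intro v
    induction v using Finsupp.induction_linear with
    | zero => exact ⟨0, fun r => by simp⟩
    | add f g hf hg =>
      obtain ⟨b, hb⟩ := hf
      obtain ⟨b', hb'⟩ := hg
      refine ⟨b + b', fun r => ?_⟩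
      rw [abs_of_nonneg (apply_nonneg _ _)]
      refine (map_add_le_add _ _ _).trans ?_
      linarith [le_abs_self (q r f), le_abs_self (q r g), hb r, hb' r]
    | single k a =>
      refine ⟨|a| * 2, fun r => ?_⟩
      have e : Finsupp.single k a = a • Finsupp.single k (1 : ℝ) := by simp
      rw [abs_of_nonneg (apply_nonneg _ _), e, map_smul_eq_mul, Real.norm_eq_abs]
      exact mul_le_mul_of_nonneg_left (hqs r k) (abs_nonneg a)
  have ht : ∀ v, Tendsto (fun r => q r v) (hyperfilter ℕ) (𝓝 (ulim fun r => q r v)) := fun v => by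
    obtain ⟨b, hb⟩ := hqb v
    exact tendsto_ulim hb
  set Q : Seminorm ℝ (ℕ →₀ ℝ) := Seminorm.of (fun v => ulim fun r => q r v)
    (fun v w => le_of_tendsto_of_tendsto' (ht (v + w)) ((ht v).add (ht w))
      fun r => map_add_le_add _ _ _)
    (fun a v => Filter.Tendsto.ulim_eq (((ht v).const_mul ‖a‖).congr
      fun r => (map_smul_eq_mul _ _ _).symm)) with hQ
  replace ht : ∀ v, Tendsto (fun r => q r v) (hyperfilter ℕ) (𝓝 (Q v)) := ht
  set z : ℕ → ℕ →₀ ℝ := fun j => Finsupp.onFinset (range (j + 1))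
    (fun i => if i ≤ j then 1 else 0) (fun i hi => by
      by_contra h
      exact hi (if_neg fun h' => h (mem_range.2 (Nat.lt_succ_of_le h')))) with hz
  have hzj : ∀ j i, z j i = if i ≤ j then 1 else 0 := fun j i => rfl
  refine not_jIneq_of_le_apply (p := Q) (z := z) (θ := θ / 2) (fun j => ?_) (half_pos hθ)
    (fun v k => ?_) (fun j k hjk => by rw [hzj, if_pos hjk]) hn₀ hγ0 hγ (fun x => ?_)
  · refine le_of_tendsto (ht (z j)) (eventually_hyperfilter_of_ge (j + 1) fun r hr => ?_)
    have e : truncate r (ι (z j)) = truncate (j + 1) (truncate r 1) := by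
      ext i
      simp only [truncate_apply, hιv, hzj, Pi.one_apply, Nat.lt_succ_iff]
      split_ifs <;> rfl
    rw [hqv, e]
    exact (htr _ _ _).trans (h1 r)
  · refine ge_of_tendsto (ht v) (eventually_hyperfilter_of_ge (k + 1) fun r hr => ?_)
    have h2 := abs_mul_apply_single_le (htr r) (truncate r (ι v)) k
    rw [truncate_apply, if_pos (by omega), hιv] at h2
    have h3 := mul_le_mul_of_nonneg_left (hk r k (by omega)) (abs_nonneg (v k))
    rw [hqv, hιv]
    linarith
  · refine le_of_tendsto_of_tendsto' (tendsto_finsetSum _ fun k _ => (ht _).pow 2)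
      ((tendsto_finsetSum _ fun i _ => (ht _).pow 2).const_mul γ) fun r => ?_
    exact (hJ r).comp (truncate r ∘ₗ ι) x

/-- Every seminorm in the class considered is small, relatively to its value at the indicator of
`[0, n)`, at one of the first `n` unit vectors. -/
def SmallCoordinate (γ : ℝ) (n₀ n : ℕ) (θ : ℝ) : Prop :=
  ∀ p : Seminorm ℝ (ℕ → ℝ), JIneq γ n₀ p → (∀ m c, p (truncate m c) ≤ p c) →
    ∃ k < n, p (Pi.single k 1) ≤ θ * p (truncate n 1)

theorem exists_smallCoordinate {γ : ℝ} {n₀ : ℕ} (hn₀ : 1 ≤ n₀) (hγ0 : 0 ≤ γ) (hγ : γ < n₀ ^ 2)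
    {θ : ℝ} (hθ : 0 < θ) : ∃ n, SmallCoordinate γ n₀ n θ := by
  obtain ⟨n, hn⟩ := exists_apply_single_lt hn₀ hγ0 hγ hθ
  refine ⟨n, fun p hJ htr => ?_⟩
  have hscale : ∀ a : ℝ, p (a • truncate n 1) ≤ 1 → ∃ k < n, p (a • Pi.single k 1) < θ := by
    intro a
    have := hn (p.comp (a • LinearMap.id)) (hJ.comp (a • LinearMap.id)) fun m c => by
      have := htr m (a • c)
      rw [map_smul] at this
      simpa [Seminorm.comp_apply] using this
    simpa only [Seminorm.comp_apply, LinearMap.smul_apply, LinearMap.id_apply] using this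
  rcases (apply_nonneg p (truncate n 1)).eq_or_lt with h0 | h0
  · obtain ⟨k, hk, -⟩ := hscale 0 (by simp)
    refine ⟨k, hk, ?_⟩
    have := abs_mul_apply_single_le htr (truncate n 1) k
    rw [← h0, truncate_apply, if_pos hk, Pi.one_apply, abs_one, one_mul] at this
    rw [← h0]
    linarith
  · obtain ⟨k, hk, hlt⟩ := hscale (p (truncate n 1))⁻¹ (by
      rw [map_smul_eq_mul, norm_inv, Real.norm_of_nonneg h0.le, inv_mul_cancel₀ h0.ne'])
    refine ⟨k, hk, ?_⟩
    rw [map_smul_eq_mul, norm_inv, Real.norm_of_nonneg h0.le, inv_mul_lt_iff₀ h0] at hlt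
    linarith

theorem SmallCoordinate.mono {γ : ℝ} {n₀ n n' : ℕ} {θ : ℝ} (h : SmallCoordinate γ n₀ n θ)
    (hθ : 0 ≤ θ) (hn : n ≤ n') : SmallCoordinate γ n₀ n' θ := by
  intro p hJ htr
  obtain ⟨k, hk, hle⟩ := h p hJ htr
  refine ⟨k, hk.trans_le hn, hle.trans (mul_le_mul_of_nonneg_left ?_ hθ)⟩
  have := htr n (truncate n' 1)
  rwa [truncate_truncate, min_eq_left hn] at this

theorem SmallCoordinate.mul {γ : ℝ} {n₀ n m : ℕ} {θ θ' : ℝ} (h : SmallCoordinate γ n₀ n θ)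
    (h' : SmallCoordinate γ n₀ m θ') (hm : 1 ≤ m) (hθ' : 0 ≤ θ') :
    SmallCoordinate γ n₀ (n * m) (θ * θ') := by
  intro p hJ htr
  obtain ⟨k, hk, hle⟩ := h (p.comp (LinearMap.funLeft ℝ ℝ fun i => i / m))
    (hJ.comp (LinearMap.funLeft ℝ ℝ fun i => i / m)) fun a c => by
      have e : LinearMap.funLeft ℝ ℝ (fun i => i / m) (truncate a c) =
          truncate (a * m) (LinearMap.funLeft ℝ ℝ (fun i => i / m) c) := by
        ext i
        simp only [LinearMap.funLeft_apply, truncate_apply, Nat.div_lt_iff_lt_mul hm]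
      rw [Seminorm.comp_apply, Seminorm.comp_apply, e]
      exact htr _ _
  set S : (ℕ → ℝ) →ₗ[ℝ] (ℕ → ℝ) :=
    { toFun := fun c i => if k * m ≤ i then c (i - k * m) else 0
      map_add' := fun c d => by ext i; by_cases h : k * m ≤ i <;> simp [h]
      map_smul' := fun a c => by ext i; by_cases h : k * m ≤ i <;> simp [h] } with hS
  have hSv : ∀ c i, S c i = if k * m ≤ i then c (i - k * m) else 0 := fun c i => rfl
  obtain ⟨j, hj, hle'⟩ := h' (p.comp S) (hJ.comp S) fun a c => by
    have e : S (truncate a c) = truncate (k * m + a) (S c) := by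
      ext i
      simp only [hSv, truncate_apply]
      split_ifs <;> first | rfl | omega
    rw [Seminorm.comp_apply, Seminorm.comp_apply, e]
    exact htr _ _
  rw [Seminorm.comp_apply, Seminorm.comp_apply] at hle hle'
  have e1 : LinearMap.funLeft ℝ ℝ (fun i => i / m) (truncate n 1) = truncate (n * m) 1 := by
    ext i
    simp only [LinearMap.funLeft_apply, truncate_apply, Nat.div_lt_iff_lt_mul hm, Pi.one_apply]
  have e2 : LinearMap.funLeft ℝ ℝ (fun i => i / m) (Pi.single k 1) = S (truncate m 1) := by
    ext i
    simp only [LinearMap.funLeft_apply, truncate_apply, hSv, Pi.one_apply, Pi.single_apply]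
    have : i / m = k ↔ k * m ≤ i ∧ i - k * m < m := by
      rw [Nat.div_eq_iff hm]
      omega
    split_ifs <;> first | rfl | omega
  have e3 : S (Pi.single j 1) = Pi.single (k * m + j) 1 := by
    ext i
    simp only [hSv, Pi.single_apply]
    split_ifs <;> first | rfl | omega
  rw [e1, e2] at hle
  rw [e3] at hle'
  refine ⟨k * m + j, ?_, ?_⟩
  · have := Nat.mul_le_mul_right m (Nat.succ_le_of_lt hk)
    rw [Nat.succ_eq_add_one, add_mul, one_mul] at this
    omega
  · have := mul_le_mul_of_nonneg_left hle hθ'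
    linarith

/-- The length needed to find a small coordinate grows polynomially with the smallness. -/
theorem exists_smallCoordinate_pow {γ : ℝ} {n₀ : ℕ} (hn₀ : 1 ≤ n₀) (hγ0 : 0 ≤ γ)
    (hγ : γ < n₀ ^ 2) : ∃ a : ℕ, ∀ k : ℕ, SmallCoordinate γ n₀ ((2 ^ a) ^ k) ((1 / 2) ^ k) := by
  obtain ⟨a, ha⟩ := exists_smallCoordinate hn₀ hγ0 hγ (θ := 1 / 2) (by norm_num)
  refine ⟨a, fun k => ?_⟩
  induction k with
  | zero =>
    intro p _ _
    refine ⟨0, by simp, le_of_eq ?_⟩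
    rw [pow_zero, pow_zero, one_mul]
    congr 1
    ext i
    simp [truncate_apply, Pi.single_apply]
  | succ k ih =>
    rw [pow_succ, pow_succ]
    exact ih.mul (ha.mono (by norm_num) Nat.lt_two_pow_self.le) Nat.one_le_two_pow (by norm_num)

end SmallCoordinate

section Trees

open Finset Metric

theorem Seminorm.exists_sq_eq_combination {E : Type*} [AddCommGroup E] [Module ℝ E]
    (p q : Seminorm ℝ E) {a b : ℝ} (ha : 0 ≤ a) (hb : 0 ≤ b) :
    ∃ r : Seminorm ℝ E, ∀ x, r x ^ 2 = a * p x ^ 2 + b * q x ^ 2 := by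
  have hnn : ∀ x, 0 ≤ a * p x ^ 2 + b * q x ^ 2 := fun x => by positivity
  refine ⟨Seminorm.of (fun x => √(a * p x ^ 2 + b * q x ^ 2)) (fun x y => ?_) (fun c x => ?_),
    fun x => Real.sq_sqrt (hnn x)⟩
  · refine Real.sqrt_le_iff.2 ⟨by positivity, ?_⟩
    have h1 : p (x + y) ^ 2 ≤ (p x + p y) ^ 2 :=
      pow_le_pow_left₀ (apply_nonneg _ _) (map_add_le_add _ _ _) 2
    have h2 : q (x + y) ^ 2 ≤ (q x + q y) ^ 2 :=
      pow_le_pow_left₀ (apply_nonneg _ _) (map_add_le_add _ _ _) 2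
    have h3 : a * p x * p y + b * q x * q y ≤
        √(a * p x ^ 2 + b * q x ^ 2) * √(a * p y ^ 2 + b * q y ^ 2) := by
      rw [← Real.sqrt_mul (hnn x)]
      refine Real.le_sqrt_of_sq_le ?_
      nlinarith [mul_nonneg (mul_nonneg ha hb) (sq_nonneg (p x * q y - p y * q x))]
    have h4 := mul_le_mul_of_nonneg_left h1 ha
    have h5 := mul_le_mul_of_nonneg_left h2 hb
    nlinarith [Real.sq_sqrt (hnn x), Real.sq_sqrt (hnn y)]
  · rw [map_smul_eq_mul, map_smul_eq_mul, mul_pow, mul_pow,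
      show a * (‖c‖ ^ 2 * p x ^ 2) + b * (‖c‖ ^ 2 * q x ^ 2) =
        ‖c‖ ^ 2 * (a * p x ^ 2 + b * q x ^ 2) by ring,
      Real.sqrt_mul (by positivity), Real.sqrt_sq (norm_nonneg c)]

theorem JIneq.of_sq_eq_combination {E : Type*} [AddCommGroup E] [Module ℝ E] {γ : ℝ} {n : ℕ}
    {p q r : E → ℝ} (hp : JIneq γ n p) (hq : JIneq γ n q) {a b : ℝ} (ha : 0 ≤ a) (hb : 0 ≤ b)
    (hr : ∀ x, r x ^ 2 = a * p x ^ 2 + b * q x ^ 2) : JIneq γ n r := by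
  intro x
  simp only [hr, sum_add_distrib, ← mul_sum]
  linarith [mul_le_mul_of_nonneg_left (hp x) ha, mul_le_mul_of_nonneg_left (hq x) hb]

variable {Y : Type*} [NormedAddCommGroup Y] [NormedSpace ℝ Y]

/-- The averages of two points of `C` at distance at least `ε`. -/
def separatedMidpoints (ε : ℝ) (C : Set Y) : Set Y :=
  {x | ∃ y ∈ C, ∃ z ∈ C, ε ≤ ‖y - z‖ ∧ x = (2⁻¹ : ℝ) • (y + z)}

/-- The iterated hulls of separated midpoints, together with a half ball. -/
def midpointHull (ε : ℝ) : ℕ → Set Y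
  | 0 => closedBall 0 1
  | k + 1 => convexHull ℝ (separatedMidpoints ε (midpointHull ε k) ∪ closedBall 0 (1 / 2))

/-- `N (c, v)` is the `L²` norm of `v + ∑ c k • d k`, for the differences `d k` of a martingale of
length `n` which starts at `x`, stays in the unit ball, and makes jumps of size at least `ε / 2`
until it is stopped in the ball of radius `1 / 2`; it is not stopped with probability `s`. -/
structure IsSeparatedTree (γ : ℝ) (n₀ : ℕ) (ε : ℝ) (n : ℕ) (x : Y) (s : ℝ)
    (N : Seminorm ℝ ((ℕ → ℝ) × Y)) : Prop where
  jIneq : JIneq γ n₀ N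
  truncate_le : ∀ m c v, N (truncate m c, v) ≤ N (c, v)
  zero_left : ∀ v, N (0, v) = ‖v‖
  le_single : ∀ k < n, ∀ v, s * (ε / 2) ^ 2 ≤ N (Pi.single k 1, v) ^ 2
  one_le : N (1, x) ≤ 1
  norm_le : ‖x‖ ≤ (1 + s) / 2
  le_one : s ≤ 1

variable {γ : ℝ} {n₀ : ℕ} {ε : ℝ} {n : ℕ}

theorem isSeparatedTree_norm (hJ : JIneq γ n₀ (fun y : Y => ‖y‖)) {x : Y} {s : ℝ}
    (hs : n = 0 ∨ s = 0) (hs1 : s ≤ 1) (hx : ‖x‖ ≤ (1 + s) / 2) :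
    IsSeparatedTree γ n₀ ε n x s ((normSeminorm ℝ Y).comp (LinearMap.snd ℝ (ℕ → ℝ) Y)) where
  jIneq := hJ.comp (LinearMap.snd ℝ (ℕ → ℝ) Y)
  truncate_le _ _ _ := le_rfl
  zero_left _ := rfl
  le_single k hk v := by
    rcases hs with rfl | rfl
    · omega
    · rw [zero_mul]; positivity
  one_le := by
    change ‖x‖ ≤ 1
    linarith
  norm_le := hx
  le_one := hs1

theorem IsSeparatedTree.norm_le_apply {x : Y} {s : ℝ} {N : Seminorm ℝ ((ℕ → ℝ) × Y)}
    (h : IsSeparatedTree γ n₀ ε n x s N) (c : ℕ → ℝ) (v : Y) : ‖v‖ ≤ N (c, v) := by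
  have e : truncate 0 c = 0 := by ext i; simp [truncate_apply]
  have := h.truncate_le 0 c v
  rwa [e, h.zero_left] at this

/-- The map `(c, v) ↦ (T c, v + c 0 • h)`. -/
def shear (T : (ℕ → ℝ) →ₗ[ℝ] (ℕ → ℝ)) (h : Y) : ((ℕ → ℝ) × Y) →ₗ[ℝ] ((ℕ → ℝ) × Y) :=
  (T ∘ₗ LinearMap.fst ℝ _ _).prod
    (LinearMap.snd ℝ _ _ + ((LinearMap.proj 0).comp (LinearMap.fst ℝ (ℕ → ℝ) Y)).smulRight h)

theorem sq_norm_convex {a b : ℝ} (ha : 0 ≤ a) (hb : 0 ≤ b) (hab : a + b = 1) (y z : Y) :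
    ‖a • y + b • z‖ ^ 2 ≤ a * ‖y‖ ^ 2 + b * ‖z‖ ^ 2 := by
  have h1 : ‖a • y + b • z‖ ≤ a * ‖y‖ + b * ‖z‖ := by
    refine (norm_add_le _ _).trans_eq ?_
    rw [norm_smul, norm_smul, Real.norm_of_nonneg ha, Real.norm_of_nonneg hb]
  have h2 := pow_le_pow_left₀ (norm_nonneg _) h1 2
  have : b = 1 - a := by linarith
  subst this
  nlinarith [mul_nonneg (mul_nonneg ha hb) (sq_nonneg (‖y‖ - ‖z‖))]

theorem IsSeparatedTree.convex {x y : Y} {s t : ℝ} {N M : Seminorm ℝ ((ℕ → ℝ) × Y)}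
    (hN : IsSeparatedTree γ n₀ ε n x s N) (hM : IsSeparatedTree γ n₀ ε n y t M)
    {a b : ℝ} (ha : 0 ≤ a) (hb : 0 ≤ b) (hab : a + b = 1) :
    ∃ L, IsSeparatedTree γ n₀ ε n (a • x + b • y) (a * s + b * t) L := by
  obtain ⟨L, hL⟩ := Seminorm.exists_sq_eq_combination
    (N.comp (shear LinearMap.id (x - (a • x + b • y))))
    (M.comp (shear LinearMap.id (y - (a • x + b • y)))) ha hb
  simp only [Seminorm.comp_apply] at hL
  have hL' : ∀ c v, L (c, v) ^ 2 = a * N (c, v + c 0 • (x - (a • x + b • y))) ^ 2 +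
      b * M (c, v + c 0 • (y - (a • x + b • y))) ^ 2 := fun c v => hL (c, v)
  have hv : ∀ (r : ℝ) (v : Y), v = a • (v + r • (x - (a • x + b • y))) +
      b • (v + r • (y - (a • x + b • y))) := by
    intro r v
    have : b = 1 - a := by linarith
    subst this
    module
  have h0 : ∀ v, L (0, v) = ‖v‖ := fun v => by
    refine (sq_eq_sq₀ (apply_nonneg _ _) (norm_nonneg _)).1 ?_
    rw [hL', Pi.zero_apply, zero_smul, zero_smul, add_zero, hN.zero_left, hM.zero_left, ← add_mul,
      hab, one_mul]
  refine ⟨L, (hN.jIneq.comp _).of_sq_eq_combination (hM.jIneq.comp _) ha hb hL,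
    fun m c v => ?_, h0, fun k hk v => ?_, ?_, ?_, ?_⟩
  · refine (sq_le_sq₀ (apply_nonneg _ _) (apply_nonneg _ _)).1 ?_
    rcases m with _ | m
    · have e : truncate 0 c = 0 := by ext i; simp [truncate_apply]
      rw [e, h0, hL']
      conv_lhs => rw [hv (c 0) v]
      refine (sq_norm_convex ha hb hab _ _).trans ?_
      gcongr
      · exact hN.norm_le_apply _ _
      · exact hM.norm_le_apply _ _
    · rw [hL', hL', truncate_apply, if_pos m.succ_pos]
      gcongr
      · exact hN.truncate_le _ _ _
      · exact hM.truncate_le _ _ _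
  · rw [hL', add_mul, mul_assoc, mul_assoc]
    exact add_le_add (mul_le_mul_of_nonneg_left (hN.le_single k hk _) ha)
      (mul_le_mul_of_nonneg_left (hM.le_single k hk _) hb)
  · refine (sq_le_sq₀ (apply_nonneg _ _) zero_le_one).1 ?_
    rw [hL', Pi.one_apply, one_smul, one_smul, add_sub_cancel, add_sub_cancel]
    have h1 := pow_le_pow_left₀ (apply_nonneg _ _) hN.one_le 2
    have h2 := pow_le_pow_left₀ (apply_nonneg _ _) hM.one_le 2
    nlinarith
  · refine (norm_add_le _ _).trans ?_
    rw [norm_smul, norm_smul, Real.norm_of_nonneg ha, Real.norm_of_nonneg hb]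
    nlinarith [mul_le_mul_of_nonneg_left hN.norm_le ha, mul_le_mul_of_nonneg_left hM.norm_le hb]
  · nlinarith [hN.le_one, hM.le_one]

theorem IsSeparatedTree.midpoint (hε : 0 ≤ ε) {x y : Y} {s t : ℝ}
    {N M : Seminorm ℝ ((ℕ → ℝ) × Y)} (hN : IsSeparatedTree γ n₀ ε n x s N)
    (hM : IsSeparatedTree γ n₀ ε n y t M) (hxy : ε ≤ ‖x - y‖) :
    ∃ L, IsSeparatedTree γ n₀ ε (n + 1) ((2⁻¹ : ℝ) • (x + y)) (2⁻¹ * s + 2⁻¹ * t) L := by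
  set h := (2⁻¹ : ℝ) • (x - y) with hh
  set T : (ℕ → ℝ) →ₗ[ℝ] (ℕ → ℝ) := LinearMap.funLeft ℝ ℝ Nat.succ with hT
  have h2 : (0 : ℝ) ≤ 2⁻¹ := by norm_num
  obtain ⟨L, hL⟩ := Seminorm.exists_sq_eq_combination
    (N.comp (shear T h)) (M.comp (shear T (-h))) h2 h2
  simp only [Seminorm.comp_apply] at hL
  have hL' : ∀ c v, L (c, v) ^ 2 = 2⁻¹ * N (T c, v + c 0 • h) ^ 2 +
      2⁻¹ * M (T c, v + c 0 • -h) ^ 2 := fun c v => hL (c, v)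
  have hv : ∀ (r : ℝ) (v : Y), v = (2⁻¹ : ℝ) • (v + r • h) + (2⁻¹ : ℝ) • (v + r • -h) := by
    intro r v
    module
  have h0 : ∀ v, L (0, v) = ‖v‖ := fun v => by
    refine (sq_eq_sq₀ (apply_nonneg _ _) (norm_nonneg _)).1 ?_
    rw [hL', Pi.zero_apply, zero_smul, zero_smul, add_zero, map_zero, hN.zero_left, hM.zero_left]
    ring
  have hsq : ∀ y z : Y, ‖(2⁻¹ : ℝ) • y + (2⁻¹ : ℝ) • z‖ ^ 2 ≤ 2⁻¹ * ‖y‖ ^ 2 + 2⁻¹ * ‖z‖ ^ 2 :=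
    sq_norm_convex h2 h2 (by norm_num)
  refine ⟨L, (hN.jIneq.comp _).of_sq_eq_combination (hM.jIneq.comp _) h2 h2 hL,
    fun m c v => ?_, h0, fun k hk v => ?_, ?_, ?_, ?_⟩
  · refine (sq_le_sq₀ (apply_nonneg _ _) (apply_nonneg _ _)).1 ?_
    rcases m with _ | m
    · have e : truncate 0 c = 0 := by ext i; simp [truncate_apply]
      rw [e, h0, hL']
      conv_lhs => rw [hv (c 0) v]
      refine (hsq _ _).trans ?_
      gcongr
      · exact hN.norm_le_apply _ _
      · exact hM.norm_le_apply _ _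
    · have e : T (truncate (m + 1) c) = truncate m (T c) := by
        ext i
        simp [hT, LinearMap.funLeft_apply, truncate_apply]
      rw [hL', hL', truncate_apply, if_pos m.succ_pos, e]
      gcongr
      · exact hN.truncate_le _ _ _
      · exact hM.truncate_le _ _ _
  · rw [hL']
    rcases k with _ | k
    · have e : T (Pi.single 0 1) = 0 := by
        ext i
        simp [hT, LinearMap.funLeft_apply]
      rw [e, Pi.single_eq_same, hN.zero_left, hM.zero_left, one_smul, one_smul]
      have h3 : h = (2⁻¹ : ℝ) • (v + h) + (2⁻¹ : ℝ) • -(v + -h) := by module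
      have h4 := hsq (v + h) (-(v + -h))
      rw [← h3, norm_neg] at h4
      have h5 : ε / 2 ≤ ‖h‖ := by
        rw [hh, norm_smul, Real.norm_of_nonneg h2]
        linarith
      have h6 := pow_le_pow_left₀ (by positivity) h5 2
      nlinarith [hN.le_one, hM.le_one, sq_nonneg (ε / 2)]
    · have e : T (Pi.single (k + 1) 1) = Pi.single k 1 := by
        ext i
        simp [hT, LinearMap.funLeft_apply, Pi.single_apply]
      rw [e, add_mul, mul_assoc, mul_assoc]
      exact add_le_add (mul_le_mul_of_nonneg_left (hN.le_single k (by omega) _) h2)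
        (mul_le_mul_of_nonneg_left (hM.le_single k (by omega) _) h2)
  · refine (sq_le_sq₀ (apply_nonneg _ _) zero_le_one).1 ?_
    have e : T 1 = 1 := rfl
    have e1 : (2⁻¹ : ℝ) • (x + y) + h = x := by rw [hh]; module
    have e2 : (2⁻¹ : ℝ) • (x + y) + -h = y := by rw [hh]; module
    rw [hL', Pi.one_apply, one_smul, one_smul, e, e1, e2]
    have h1 := pow_le_pow_left₀ (apply_nonneg _ _) hN.one_le 2
    have h2 := pow_le_pow_left₀ (apply_nonneg _ _) hM.one_le 2
    linarith
  · rw [norm_smul, Real.norm_of_nonneg h2]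
    linarith [norm_add_le x y, hN.norm_le, hM.norm_le]
  · linarith [hN.le_one, hM.le_one]

theorem exists_isSeparatedTree (hJ : JIneq γ n₀ (fun y : Y => ‖y‖)) (hε : 0 ≤ ε) (n : ℕ) :
    ∀ x ∈ midpointHull (Y := Y) ε n, ∃ s N, IsSeparatedTree γ n₀ ε n x s N := by
  induction n with
  | zero =>
    intro x hx
    refine ⟨1, _, isSeparatedTree_norm hJ (Or.inl rfl) le_rfl ?_⟩
    have := mem_closedBall_zero_iff.1 hx
    linarith
  | succ n ih =>
    have hconv : Convex ℝ {x : Y | ∃ s N, IsSeparatedTree γ n₀ ε (n + 1) x s N} := by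
      rintro x ⟨s, N, hN⟩ y ⟨t, M, hM⟩ a b ha hb hab
      obtain ⟨L, hL⟩ := hN.convex hM ha hb hab
      exact ⟨_, L, hL⟩
    intro x hx
    refine convexHull_min ?_ hconv hx
    rintro z (⟨x, hx, y, hy, hxy, rfl⟩ | hz)
    · obtain ⟨s, N, hN⟩ := ih x hx
      obtain ⟨t, M, hM⟩ := ih y hy
      obtain ⟨L, hL⟩ := hN.midpoint hε hM hxy
      exact ⟨_, L, hL⟩
    · have := mem_closedBall_zero_iff.1 hz
      exact ⟨0, _, isSeparatedTree_norm hJ (Or.inr rfl) zero_le_one (by linarith)⟩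

theorem norm_le_of_mem_midpointHull (hJ : JIneq γ n₀ (fun y : Y => ‖y‖)) {θ : ℝ} (hθ : 0 < θ)
    (hn : SmallCoordinate γ n₀ n θ) (hε : 8 * θ ≤ ε) {x : Y} (hx : x ∈ midpointHull ε n) :
    ‖x‖ ≤ 3 / 4 := by
  by_contra! hlt
  obtain ⟨s, N, hN⟩ := exists_isSeparatedTree hJ (by linarith) n x hx
  obtain ⟨k, hk, hle⟩ := hn (N.comp (LinearMap.inl ℝ (ℕ → ℝ) Y)) (hN.jIneq.comp _)
    fun m c => hN.truncate_le m c 0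
  simp only [Seminorm.comp_apply, LinearMap.inl_apply] at hle
  have h1 : N (truncate n 1, 0) ≤ 2 := by
    have e : ((truncate n 1, 0) : (ℕ → ℝ) × Y) = (truncate n 1, x) - (0, x) := by simp
    rw [e]
    refine (map_sub_le_add N _ _).trans ?_
    rw [hN.zero_left]
    linarith [hN.truncate_le n 1 x, hN.one_le, hN.norm_le_apply 1 x]
  have h2 := hN.le_single k hk 0
  have h3 : N (Pi.single k 1, 0) ≤ 2 * θ := by nlinarith
  have h4 := pow_le_pow_left₀ (apply_nonneg _ _) h3 2
  have h5 := hN.norm_le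
  have h6 : (4 * θ) ^ 2 ≤ (ε / 2) ^ 2 := pow_le_pow_left₀ (by positivity) (by linarith) 2
  have h7 : 1 / 2 * (4 * θ) ^ 2 ≤ s * (ε / 2) ^ 2 := by
    refine mul_le_mul (by linarith) h6 (by positivity) (by linarith)
  nlinarith

end Trees

section Renorming

open Metric Set
open scoped Pointwise

theorem Seminorm.exists_hasSum_sq {E ι : Type*} [AddCommGroup E] [Module ℝ E] {w : ι → ℝ}
    (hw : ∀ i, 0 ≤ w i) (g : ι → Seminorm ℝ E) (hg : ∀ x, Summable fun i => w i * g i x ^ 2) :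
    ∃ N : Seminorm ℝ E, ∀ x, HasSum (fun i => w i * g i x ^ 2) (N x ^ 2) := by
  have hnn : ∀ x i, 0 ≤ w i * g i x ^ 2 := fun x i => mul_nonneg (hw i) (sq_nonneg _)
  have hrw : ∀ x i, (√(w i) * g i x) ^ (2 : ℝ) = w i * g i x ^ 2 := fun x i => by
    rw [Real.rpow_two, mul_pow, Real.sq_sqrt (hw i)]
  refine ⟨Seminorm.of (fun x => √(∑' i, w i * g i x ^ 2)) (fun x y => ?_) (fun a x => ?_),
    fun x => ?_⟩
  · have h := Real.Lp_add_le_tsum_of_nonneg (f := fun i => √(w i) * g i x)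
      (g := fun i => √(w i) * g i y) one_le_two
      (fun i => mul_nonneg (Real.sqrt_nonneg _) (apply_nonneg _ _))
      (fun i => mul_nonneg (Real.sqrt_nonneg _) (apply_nonneg _ _))
      (by simpa only [hrw] using hg x) (by simpa only [hrw] using hg y)
    simp only [hrw, ← Real.sqrt_eq_rpow] at h
    refine le_trans (Real.sqrt_le_sqrt ((hg (x + y)).tsum_le_tsum (fun i => ?_) h.1)) h.2
    rw [Real.rpow_two, ← mul_add, mul_pow, Real.sq_sqrt (hw i)]
    have := hw i
    gcongr
    exact map_add_le_add _ _ _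
  · have : ∀ i, w i * g i (a • x) ^ 2 = ‖a‖ ^ 2 * (w i * g i x ^ 2) := fun i => by
      rw [map_smul_eq_mul]; ring
    simp only [this]
    rw [tsum_mul_left, Real.sqrt_mul (by positivity), Real.sqrt_sq (norm_nonneg a)]
  · change HasSum _ (√(∑' i, w i * g i x ^ 2) ^ 2)
    rw [Real.sq_sqrt (tsum_nonneg (hnn x))]
    exact (hg x).hasSum

variable {Y : Type*} [NormedAddCommGroup Y] [NormedSpace ℝ Y]

theorem convex_midpointHull (ε : ℝ) (k : ℕ) : Convex ℝ (midpointHull (Y := Y) ε k) := by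
  cases k with
  | zero => exact convex_closedBall 0 1
  | succ k => exact convex_convexHull ℝ _

theorem closedBall_subset_midpointHull (ε : ℝ) (k : ℕ) :
    closedBall (0 : Y) (1 / 2) ⊆ midpointHull ε k := by
  cases k with
  | zero => exact closedBall_subset_closedBall (by norm_num)
  | succ k => exact subset_union_right.trans (subset_convexHull ℝ _)

theorem midpointHull_subset_closedBall (ε : ℝ) (k : ℕ) :
    midpointHull ε k ⊆ closedBall (0 : Y) 1 := by
  induction k with
  | zero => exact subset_rfl
  | succ k ih =>
    refine convexHull_min (union_subset ?_ (closedBall_subset_closedBall (by norm_num)))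
      (convex_closedBall 0 1)
    rintro _ ⟨y, hy, z, hz, -, rfl⟩
    have h1 := mem_closedBall_zero_iff.1 (ih hy)
    have h2 := mem_closedBall_zero_iff.1 (ih hz)
    rw [mem_closedBall_zero_iff, norm_smul, Real.norm_of_nonneg (by norm_num)]
    linarith [norm_add_le y z]

theorem neg_mem_midpointHull {ε : ℝ} {k : ℕ} {x : Y} (hx : x ∈ midpointHull ε k) :
    -x ∈ midpointHull ε k := by
  induction k generalizing x with
  | zero => simpa [midpointHull] using hx
  | succ k ih =>
    have h : convexHull ℝ (separatedMidpoints ε (midpointHull ε k) ∪ closedBall (0 : Y) (1 / 2)) ⊆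
        -midpointHull ε (k + 1) := by
      refine convexHull_min ?_ (convex_midpointHull ε (k + 1)).neg
      rintro z (⟨y, hy, z, hz, hyz, rfl⟩ | hz)
      · refine Set.mem_neg.2 (subset_convexHull ℝ _ (Or.inl ⟨-y, ih hy, -z, ih hz, ?_, ?_⟩))
        · rwa [← neg_sub', norm_neg]
        · rw [← neg_add, smul_neg]
      · exact Set.mem_neg.2 (closedBall_subset_midpointHull ε (k + 1) (by simpa using hz))
    exact h hx

theorem balanced_midpointHull (ε : ℝ) (k : ℕ) : Balanced ℝ (midpointHull (Y := Y) ε k) := by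
  rintro a ha _ ⟨x, hx, rfl⟩
  obtain ⟨h1, h2⟩ := abs_le.1 ha
  have := convex_midpointHull ε k hx (neg_mem_midpointHull hx)
    (show 0 ≤ (1 + a) / 2 by linarith) (show 0 ≤ (1 - a) / 2 by linarith) (by ring)
  convert this using 1
  module

theorem absorbent_midpointHull (ε : ℝ) (k : ℕ) : Absorbent ℝ (midpointHull (Y := Y) ε k) :=
  (absorbent_ball_zero (by norm_num)).mono
    (ball_subset_closedBall.trans (closedBall_subset_midpointHull ε k))

/-- The norm whose unit ball is `midpointHull ε k`. -/
def hullSeminorm (ε : ℝ) (k : ℕ) : Seminorm ℝ Y :=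
  gaugeSeminorm (balanced_midpointHull ε k) (convex_midpointHull ε k) (absorbent_midpointHull ε k)

theorem hullSeminorm_apply (ε : ℝ) (k : ℕ) (x : Y) :
    hullSeminorm ε k x = gauge (midpointHull ε k) x := rfl

theorem hullSeminorm_le_norm (ε : ℝ) (k : ℕ) (x : Y) : hullSeminorm ε k x ≤ 2 * ‖x‖ := by
  have := mul_gauge_le_norm (x := x)
    (ball_subset_closedBall.trans (closedBall_subset_midpointHull (Y := Y) ε k))
  rw [hullSeminorm_apply]
  linarith

theorem hullSeminorm_zero (ε : ℝ) (x : Y) : hullSeminorm ε 0 x = ‖x‖ := by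
  rw [hullSeminorm_apply, midpointHull, gauge_closedBall zero_le_one, div_one]

theorem mem_midpointHull_of_hullSeminorm_lt {ε : ℝ} {k : ℕ} {x : Y} {r : ℝ} (hr : 0 < r)
    (hx : hullSeminorm ε k x < r) : r⁻¹ • x ∈ midpointHull ε k := by
  refine setOfPred_gauge_lt_one_subset_self (convex_midpointHull ε k)
    (absorbent_midpointHull ε k).zero_mem (absorbent_midpointHull ε k) ?_
  change hullSeminorm ε k (r⁻¹ • x) < 1
  rwa [map_smul_eq_mul, norm_inv, Real.norm_of_nonneg hr.le, inv_mul_lt_one₀ hr]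

theorem hullSeminorm_succ_midpoint_le {ε : ℝ} {k : ℕ} {x y : Y} {r : ℝ}
    (hx : hullSeminorm ε k x < r) (hy : hullSeminorm ε k y < r) (hxy : r * ε ≤ ‖x - y‖) :
    hullSeminorm ε (k + 1) ((2⁻¹ : ℝ) • (x + y)) ≤ r := by
  have hr : 0 < r := (apply_nonneg _ _).trans_lt hx
  have h : r⁻¹ • ((2⁻¹ : ℝ) • (x + y)) ∈ midpointHull ε (k + 1) := by
    refine subset_convexHull ℝ _ (Or.inl ⟨_, mem_midpointHull_of_hullSeminorm_lt hr hx, _,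
      mem_midpointHull_of_hullSeminorm_lt hr hy, ?_, ?_⟩)
    · rwa [← smul_sub, norm_smul, norm_inv, Real.norm_of_nonneg hr.le, ← div_eq_inv_mul,
        le_div_iff₀' hr]
    · rw [← smul_add, smul_comm]
  have h1 : hullSeminorm ε (k + 1) (r⁻¹ • ((2⁻¹ : ℝ) • (x + y))) ≤ 1 := gauge_le_one_of_mem h
  rwa [map_smul_eq_mul, norm_inv, Real.norm_of_nonneg hr.le, inv_mul_le_one₀ hr] at h1

theorem norm_le_mul_hullSeminorm {ε : ℝ} {n : ℕ} {ρ : ℝ} (hρ : 0 < ρ)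
    (h : ∀ x ∈ midpointHull (Y := Y) ε n, ‖x‖ ≤ ρ) (x : Y) : ‖x‖ ≤ ρ * hullSeminorm ε n x := by
  have := le_gauge_of_subset_closedBall (x := x) (absorbent_midpointHull ε n) hρ.le
    fun y hy => mem_closedBall_zero_iff.2 (h y hy)
  rwa [div_le_iff₀' hρ] at this

/-- If the norms `hullSeminorm ε k`, `k ≤ n`, are all nearly affine on the segment `[x, y]`, then
`x` and `y` are close to each other. -/
theorem norm_sub_le_of_hullSeminorm {ε : ℝ} {n : ℕ}
    (h : ∀ x ∈ midpointHull (Y := Y) ε n, ‖x‖ ≤ 3 / 4) {x y : Y} (hx : ‖x‖ ≤ 1) (hy : ‖y‖ ≤ 1)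
    (hxy : 3 * ε ≤ ‖x - y‖) (hε : 0 ≤ ε) {ζ : ℝ} (hζ : 0 ≤ ζ)
    (hdef : ∀ k ≤ n, (hullSeminorm ε k x ^ 2 + hullSeminorm ε k y ^ 2) / 2 -
      hullSeminorm ε k ((2⁻¹ : ℝ) • (x + y)) ^ 2 ≤ ζ ^ 2) :
    ‖x - y‖ ≤ 16 * (n + 1) * ζ := by
  set m := (2⁻¹ : ℝ) • (x + y) with hm
  have hend : ∀ k ≤ n, hullSeminorm ε k x ≤ hullSeminorm ε k m + 2 * ζ ∧
      hullSeminorm ε k y ≤ hullSeminorm ε k m + 2 * ζ := by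
    intro k hk
    have h1 := hdef k hk
    have h2 : hullSeminorm ε k m ≤ (hullSeminorm ε k x + hullSeminorm ε k y) / 2 := by
      rw [hm, map_smul_eq_mul, Real.norm_of_nonneg (by norm_num)]
      linarith [map_add_le_add (hullSeminorm ε k) x y]
    have h0 : 0 ≤ hullSeminorm ε k m := apply_nonneg _ _
    generalize hullSeminorm ε k x = a at *
    generalize hullSeminorm ε k y = b at *
    generalize hullSeminorm ε k m = c at *
    have h3 : |(a - b) / 2| ≤ ζ := abs_le_of_sq_le_sq (by nlinarith) hζ
    have h4 : (a + b) / 2 ≤ c + ζ := by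
      refine le_of_sq_le_sq (by nlinarith [mul_nonneg h0 hζ, sq_nonneg (a - b)]) (by positivity)
    obtain ⟨h5, h6⟩ := abs_le.1 h3
    constructor <;> linarith
  have hchain : ∀ k < n, hullSeminorm ε (k + 1) m ≤ hullSeminorm ε k m + 2 * ζ := by
    intro k hk
    obtain ⟨h1, h2⟩ := hend k hk.le
    have h3 := hullSeminorm_le_norm ε k x
    have h4 := hullSeminorm_le_norm ε k y
    refine le_trans (le_of_forall_pos_le_add fun δ hδ => ?_) (max_le h1 h2)
    refine (hullSeminorm_succ_midpoint_le (r := max (hullSeminorm ε k x) (hullSeminorm ε k y) +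
      min δ 1) ?_ ?_ (le_trans ?_ hxy)).trans (add_le_add_right (min_le_left _ _) _)
    · exact (le_max_left _ _).trans_lt (lt_add_of_pos_right _ (by positivity))
    · exact (le_max_right _ _).trans_lt (lt_add_of_pos_right _ (by positivity))
    · refine mul_le_mul_of_nonneg_right ?_ hε
      linarith [min_le_right δ 1, max_le (h3.trans (by linarith : 2 * ‖x‖ ≤ 2))
        (h4.trans (by linarith : 2 * ‖y‖ ≤ 2))]
  have hsum : ∀ k ≤ n, hullSeminorm ε k m ≤ ‖m‖ + 2 * k * ζ := by
    intro k
    induction k with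
    | zero => intro _; rw [hullSeminorm_zero]; simp
    | succ k ih =>
      intro hk
      push_cast
      linarith [hchain k hk, ih (by omega)]
  have h1 := hsum n le_rfl
  have h2 := norm_le_mul_hullSeminorm (by norm_num) h m
  have h3 := hend 0 n.zero_le
  simp only [hullSeminorm_zero] at h3
  have h4 := norm_sub_le x y
  linarith [h3.1, h3.2]

/-- A polynomially growing family of hulls which shrink yields an equivalent norm with modulus of
convexity of power type. -/
theorem exists_q_convex_of_midpointHull {a : ℕ}
    (h : ∀ j : ℕ, ∀ x ∈ midpointHull (Y := Y) ((1 / 2) ^ j) ((2 ^ a) ^ (j + 3)), ‖x‖ ≤ 3 / 4) :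
    ∃ (q : ℕ) (c B : ℝ) (N : Seminorm ℝ Y), 2 ≤ q ∧ 0 < c ∧ 0 < B ∧
      (∀ y, ‖y‖ ≤ N y ∧ N y ≤ B * ‖y‖) ∧
      ∀ x y, N x ≤ 1 → N y ≤ 1 → ∀ ε : ℝ, 0 < ε → ε ≤ 2 → ε ≤ N (x - y) →
        N ((2⁻¹ : ℝ) • (x + y)) ≤ 1 - c * ε ^ q := by
  set u : ℕ → ℝ := fun k => 1 / ((k : ℝ) + 1) ^ 2 with hu
  have hu0 : ∀ k, 0 < u k := fun k => by positivity
  have hus : Summable u := by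
    have := (summable_nat_add_iff 1).2 (Real.summable_one_div_nat_pow.2 one_lt_two)
    simpa [hu] using this
  have hws : Summable fun i : ℕ × ℕ => u i.1 * u i.2 :=
    hus.mul_of_nonneg hus (fun k => (hu0 k).le) fun k => (hu0 k).le
  have hw0 : ∀ i : ℕ × ℕ, 0 < u i.1 * u i.2 := fun i => mul_pos (hu0 _) (hu0 _)
  set g : ℕ × ℕ → Seminorm ℝ Y := fun i => hullSeminorm ((1 / 2) ^ i.1) i.2 with hg
  have hgle : ∀ x i, u i.1 * u i.2 * g i x ^ 2 ≤ u i.1 * u i.2 * (2 * ‖x‖) ^ 2 := fun x i =>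
    mul_le_mul_of_nonneg_left
      (pow_le_pow_left₀ (apply_nonneg _ _) (hullSeminorm_le_norm _ _ _) 2) (hw0 i).le
  have hgnn : ∀ x i, 0 ≤ u i.1 * u i.2 * g i x ^ 2 := fun x i =>
    mul_nonneg (hw0 i).le (sq_nonneg _)
  obtain ⟨N, hN⟩ := Seminorm.exists_hasSum_sq (fun i => (hw0 i).le) g fun x =>
    Summable.of_nonneg_of_le (hgnn x) (hgle x) (hws.mul_right _)
  set W := ∑' i : ℕ × ℕ, u i.1 * u i.2 with hW
  have hW0 : 0 ≤ W := tsum_nonneg fun i => (hw0 i).le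
  set B := 2 * √W + 1 with hB
  have hB1 : 1 ≤ B := by linarith [Real.sqrt_nonneg W]
  have hlow : ∀ y, ‖y‖ ≤ N y := fun y => by
    refine (sq_le_sq₀ (norm_nonneg _) (apply_nonneg _ _)).1 ?_
    have := le_hasSum (hN y) (0, 0) fun i _ => hgnn y i
    simpa [hu, hg, hullSeminorm_zero] using this
  have hup : ∀ y, N y ≤ B * ‖y‖ := fun y => by
    have h1 : N y ^ 2 ≤ W * (2 * ‖y‖) ^ 2 :=
      hasSum_le (hgle y) (hN y) (hws.hasSum.mul_right _)
    have h2 : N y ≤ √W * (2 * ‖y‖) := by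
      refine le_of_sq_le_sq ?_ (by positivity)
      rwa [mul_pow, Real.sq_sqrt hW0]
    linarith [norm_nonneg y]
  refine ⟨4 * a + 4, 1 / 2 * ((1 / B) ^ 2 * (1 / 2 ^ (12 * a + 12)) *
    (1 / (6 * B)) ^ (4 * a + 2)), B, N, by omega, by positivity, by positivity,
    fun y => ⟨hlow y, hup y⟩, fun x y hx hy ε hε0 hε2 hε => ?_⟩
  set m := (2⁻¹ : ℝ) • (x + y) with hm
  have hεB : ε / B ≤ ‖x - y‖ := by
    rw [div_le_iff₀' (by positivity)]
    exact hε.trans (hup _)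
  obtain ⟨i, hi1, hi2⟩ := exists_nat_pow_near_of_lt_one (x := ε / (3 * B)) (y := (1 / 2 : ℝ))
    (by positivity) (by rw [div_le_one (by positivity)]; linarith) (by norm_num) (by norm_num)
  set j := i + 1 with hj
  set n := (2 ^ a) ^ (j + 3) with hn
  set η := 1 - N m ^ 2 with hη
  have hNm : N m ≤ 1 := by
    rw [hm, map_smul_eq_mul, Real.norm_of_nonneg (by norm_num)]
    linarith [map_add_le_add N x y]
  have hη0 : 0 ≤ η := by nlinarith [apply_nonneg N m]
  have hpos : ∀ i, 0 ≤ (g i x ^ 2 + g i y ^ 2) / 2 - g i m ^ 2 := fun i => by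
    have h1 : g i m ≤ (g i x + g i y) / 2 := by
      rw [hm, map_smul_eq_mul, Real.norm_of_nonneg (by norm_num)]
      linarith [map_add_le_add (g i) x y]
    have h2 := pow_le_pow_left₀ (apply_nonneg _ _) h1 2
    nlinarith [sq_nonneg (g i x - g i y)]
  have hdefect : ∀ i : ℕ × ℕ, u i.1 * u i.2 * ((g i x ^ 2 + g i y ^ 2) / 2 - g i m ^ 2) ≤ η := by
    intro i
    have hS := (((hN x).add (hN y)).div_const 2).sub (hN m)
    have h1 := le_hasSum hS i fun k _ => ?_
    · have h2 := pow_le_pow_left₀ (apply_nonneg _ _) hx 2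
      have h3 := pow_le_pow_left₀ (apply_nonneg _ _) hy 2
      rw [hη]
      calc _ = _ := by ring
        _ ≤ _ := h1
        _ ≤ _ := by linarith
    · calc 0 ≤ _ := mul_nonneg (hw0 k).le (hpos k)
        _ = _ := by ring
  set ω := u j * u n with hω
  have hω0 : 0 < ω := hw0 (j, n)
  have hζ := norm_sub_le_of_hullSeminorm (h j) ((hlow x).trans hx) ((hlow y).trans hy)
    (le_trans (by rw [lt_div_iff₀ (by positivity)] at hi1; rw [le_div_iff₀ (by positivity)]
                  linarith) hεB)
    (by positivity) (Real.sqrt_nonneg (η / ω)) fun k hk => by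
      rw [Real.sq_sqrt (by positivity), le_div_iff₀' hω0]
      refine le_trans (mul_le_mul_of_nonneg_right ?_ ?_) (hdefect (j, k))
      · refine mul_le_mul_of_nonneg_left ?_ (hu0 j).le
        simp only [hu]
        gcongr
      · exact hpos (j, k)
  have hn1 : ((n : ℕ) : ℝ) + 1 ≤ 2 * n := by
    have : 1 ≤ n := Nat.one_le_pow _ _ (by positivity)
    have : (1 : ℝ) ≤ n := by exact_mod_cast this
    linarith
  have hj1 : (j : ℝ) + 1 ≤ 2 ^ j := by exact_mod_cast Nat.lt_two_pow_self
  have hmain : (ε / B) ^ 2 ≤ 2 ^ (12 * a + 12) * (2 ^ j) ^ (4 * a + 2) * η := by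
    have h1 := pow_le_pow_left₀ (by positivity) (hεB.trans hζ) 2
    rw [mul_pow, Real.sq_sqrt (by positivity)] at h1
    have h2 : η / ω = ((j : ℝ) + 1) ^ 2 * ((n : ℝ) + 1) ^ 2 * η := by
      simp only [hω, hu]
      field_simp
    rw [h2] at h1
    refine h1.trans ?_
    calc (16 * ((n : ℝ) + 1)) ^ 2 * (((j : ℝ) + 1) ^ 2 * ((n : ℝ) + 1) ^ 2 * η)
        ≤ (16 * (2 * (n : ℝ))) ^ 2 * ((2 ^ j) ^ 2 * (2 * (n : ℝ)) ^ 2 * η) := by gcongr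
      _ = 2 ^ 12 * (n : ℝ) ^ 4 * (2 ^ j) ^ 2 * η := by ring
      _ = _ := by rw [hn]; push_cast; ring
  have h2j : ε / (6 * B) ≤ 1 / 2 ^ j := by
    have : ε / (6 * B) = ε / (3 * B) / 2 := by field_simp; norm_num
    rw [this, ← one_div_pow, hj, pow_succ]
    linarith
  have hfin : (1 / B) ^ 2 * (1 / 2 ^ (12 * a + 12)) * (1 / (6 * B)) ^ (4 * a + 2) *
      ε ^ (4 * a + 4) ≤ η := by
    calc _ = (ε / B) ^ 2 * (1 / 2 ^ (12 * a + 12)) * (ε / (6 * B)) ^ (4 * a + 2) := by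
          rw [div_pow, div_pow, div_pow, div_pow, show 4 * a + 4 = 2 + (4 * a + 2) by ring, pow_add]
          ring
      _ ≤ (2 ^ (12 * a + 12) * (2 ^ j) ^ (4 * a + 2) * η) * (1 / 2 ^ (12 * a + 12)) *
          (1 / 2 ^ j) ^ (4 * a + 2) := by gcongr
      _ = η := by rw [div_pow, one_pow]; field_simp
  nlinarith [apply_nonneg N m]

end Renorming

/-- Pisier's theorem: a Banach space is superreflexive iff it admits an equivalent
`q`-convex norm for some `q ∈ [2,∞)`. -/
theorem superreflexive_iff_equivalent_q_convex_norm
    (Y : Type) [NormedAddCommGroup Y] [NormedSpace ℝ Y] [CompleteSpace Y] :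
    SuperReflexive Y ↔
      ∃ q : ℝ, 2 ≤ q ∧ ∃ c : ℝ, 0 < c ∧ ∃ N : Y → ℝ,
        -- `N` is a norm on `Y`:
        (∀ y, 0 ≤ N y) ∧
        (∀ y, N y = 0 ↔ y = 0) ∧
        (∀ (a : ℝ) (y : Y), N (a • y) = |a| * N y) ∧
        (∀ y z : Y, N (y + z) ≤ N y + N z) ∧
        -- `N` is equivalent to the original norm:
        (∃ A B : ℝ, 0 < A ∧ 0 < B ∧ ∀ y : Y, A * ‖y‖ ≤ N y ∧ N y ≤ B * ‖y‖) ∧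
        -- `N` is `q`-convex with constant `c`:
        (∀ x y : Y, N x ≤ 1 → N y ≤ 1 → ∀ ε : ℝ, 0 < ε → ε ≤ 2 → ε ≤ N (x - y) →
          N ((2⁻¹ : ℝ) • (x + y)) ≤ 1 - c * ε ^ q) := by
  constructor
  · intro hY
    obtain ⟨n₀, hn₀, h⟩ := hY.exists_jconvex
    obtain ⟨γ, hγ0, hγ, hJ⟩ := exists_jIneq_of_jconvex hn₀ h
    obtain ⟨a, ha⟩ := exists_smallCoordinate_pow hn₀ hγ0 hγ
    obtain ⟨q, c, B, N, hq, hc, hB, hNB, hN⟩ := exists_q_convex_of_midpointHull (Y := Y) (a := a)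
      fun j x hx => norm_le_of_mem_midpointHull hJ (by positivity) (ha (j + 3))
        (by rw [pow_add]; norm_num; linarith) hx
    refine ⟨q, by exact_mod_cast hq, c, hc, N, fun y => apply_nonneg N y,
      fun y => ⟨fun h => ?_, ?_⟩, fun a y => map_smul_eq_mul N a y, fun y z => map_add_le_add N y z,
      ⟨1, B, one_pos, hB, fun y => by simpa using hNB y⟩, fun x y hx hy ε hε0 hε2 hε => ?_⟩
    · exact norm_le_zero_iff.1 ((hNB y).1.trans_eq h)
    · rintro rfl
      exact map_zero N
    · rw [Real.rpow_natCast]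
      exact hN x y hx hy ε hε0 hε2 hε
  · rintro ⟨q, -, c, hc, N, -, -, hsmul, hadd, ⟨A, B, hA, hB, hAB⟩, hN⟩
    exact superReflexive_of_q_convex hc hsmul hadd hA hB (fun y => (hAB y).1)
      (fun y => (hAB y).2) hN
end
end
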